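/- arXiv:2311.00788 — 11 statements merged into one kernel-verified Lean document; each statement's English description precedes it below -/
import Mathlib

section
/- Let F be a finite field with q elements, let 𝒞 ⊆ F^n be a linear code of dimension k, and let d ≥ 1 be an integer. Then there exists a subset T ⊆ {1,…,n} with |T| ≤ k·d such that, setting S = {1,…,n}∖T, for every integer α with 1 ≤ α ≤ k, the punctured code 𝒞|_S contains at most q^α · binom(k, α) distinct codewords of Hamming weight at most α·d. -/
open Classical in
/-- Support of a code. -/
noncomputable def codeSupp {F : Type} [Field F] {ι : Type} [Fintype ι]
    (E : Submodule F (ι → F)) : Finset ι :=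
  Finset.univ.filter (fun i => ∃ c ∈ E, c i ≠ 0)

lemma mem_codeSupp {F : Type} [Field F] {ι : Type} [Fintype ι]
    {E : Submodule F (ι → F)} {i : ι} : i ∈ codeSupp E ↔ ∃ c ∈ E, c i ≠ 0 := by
  simp [codeSupp]

open Classical in
/-- Low weight codewords. -/
noncomputable def codeLow {F : Type} [Field F] [Fintype F] [DecidableEq F] {ι : Type} [Fintype ι]
    (E : Submodule F (ι → F)) (w : ℕ) : Finset (ι → F) :=
  Finset.univ.filter (fun c => c ∈ E ∧ hammingNorm c ≤ w)

lemma codeSlice_finrank {F : Type} [Field F] {ι : Type} [Fintype ι]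
    (C : Submodule F (ι → F)) (i : ι) (hi : i ∈ codeSupp C) :
    Module.finrank F ↥(C ⊓ LinearMap.ker (LinearMap.proj (R := F) (φ := fun _ : ι => F) i)) + 1
      = Module.finrank F C := by
  classical
  obtain ⟨c, hc, hci⟩ : ∃ c ∈ C, c i ≠ 0 := by simpa [codeSupp] using hi
  set f : C →ₗ[F] F := (LinearMap.proj (R := F) (φ := fun _ : ι => F) i).comp C.subtype with hf
  have hsurj : Function.Surjective f := by
    apply LinearMap.surjective
    intro h
    apply hci
    have := LinearMap.congr_fun h ⟨c, hc⟩
    simpa [hf] using this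
  have h1 := LinearMap.finrank_range_add_finrank_ker f
  rw [LinearMap.range_eq_top.2 hsurj, finrank_top, Module.finrank_self] at h1
  have h2 : C ⊓ LinearMap.ker (LinearMap.proj (R := F) (φ := fun _ : ι => F) i)
      = (LinearMap.ker f).map C.subtype := by
    ext x
    simp [hf, and_comm]
  rw [h2, Submodule.finrank_map_subtype_eq]
  omega

lemma codeLow_card_le {F : Type} [Field F] [Fintype F] [DecidableEq F] {ι : Type} [Fintype ι]
    (d α m : ℕ) (hd : 1 ≤ d) (C : Submodule F (ι → F))
    (hC : Module.finrank F C = α + m)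
    (hE : ∀ E ≤ C, d * Module.finrank F E ≤ (codeSupp E).card) :
    (codeLow C (α * d)).card ≤ Fintype.card F ^ α * (α + m).choose α := by
  classical
  induction m generalizing C with
  | zero =>
    have h1 : (codeLow C (α * d)).card ≤ Fintype.card C := by
      rw [Fintype.card_subtype]
      apply Finset.card_le_card
      intro x hx
      simp only [codeLow, Finset.mem_filter] at hx ⊢
      exact ⟨Finset.mem_univ _, hx.2.1⟩
    rw [Module.card_eq_pow_finrank (K := F) (V := C), hC] at h1
    simpa using h1
  | succ m ih =>
    set s := (codeSupp C).card with hs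
    have hsd : d * (α + (m + 1)) ≤ s := by rw [← hC]; exact hE C le_rfl
    set B := Fintype.card F ^ α * (α + m).choose α with hB
    have key := Finset.sum_card_bipartiteAbove_eq_sum_card_bipartiteBelow
      (s := codeLow C (α * d)) (t := codeSupp C) (fun c i => c i = 0)
    have up : ∑ i ∈ codeSupp C,
        ((codeLow C (α * d)).bipartiteBelow (fun c i => c i = 0) i).card ≤ s * B := by
      rw [hs, ← smul_eq_mul]
      apply Finset.sum_le_card_nsmul
      intro i hi
      have h1 := codeSlice_finrank C i hi
      have h2 := ih (C ⊓ LinearMap.ker (LinearMap.proj (R := F) (φ := fun _ : ι => F) i))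
        (by omega) (fun E hEC => hE E (hEC.trans inf_le_left))
      refine le_trans (Finset.card_le_card ?_) h2
      intro c hc
      simp only [codeLow, Finset.bipartiteBelow, Finset.mem_filter, Finset.mem_univ, true_and] at hc ⊢
      exact ⟨⟨hc.1.1, by simpa using hc.2⟩, hc.1.2⟩
    have lo : (codeLow C (α * d)).card * (s - α * d) ≤ ∑ c ∈ codeLow C (α * d),
        ((codeSupp C).bipartiteAbove (fun c i => c i = 0) c).card := by
      rw [← smul_eq_mul]
      apply Finset.card_nsmul_le_sum
      intro c hc
      simp only [codeLow, Finset.mem_filter, Finset.mem_univ, true_and] at hc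
      have h1 := Finset.card_filter_add_card_filter_not (s := codeSupp C) (fun i => c i = 0)
      have h2 : ((codeSupp C).filter (fun i => ¬ c i = 0)).card ≤ hammingNorm c := by
        unfold hammingNorm
        apply Finset.card_le_card
        intro i hi
        simp only [Finset.mem_filter, Finset.mem_univ, true_and] at hi ⊢
        exact hi.2
      have h3 := hc.2
      simp only [Finset.bipartiteAbove]
      omega
    rw [key] at lo
    have h := lo.trans up
    have hch : (α + m + 1) * (α + m).choose α = (α + m + 1).choose α * (m + 1) := by
      have := Nat.choose_mul_succ_eq (α + m) α
      rw [show α + m + 1 - α = m + 1 by omega] at this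
      rw [← this, mul_comm]
    set N := (codeLow C (α * d)).card
    obtain ⟨t, ht⟩ : ∃ t, s = α * d + t := ⟨s - α * d, by
      have : α * d ≤ d * (α + (m+1)) := by nlinarith
      omega⟩
    rw [ht] at h hsd
    rw [Nat.add_sub_cancel_left] at h
    have htd : d * (m + 1) ≤ t := by nlinarith
    have htpos : 0 < t := by nlinarith
    have h5 : N * t * (m + 1) ≤ Fintype.card F ^ α * (α + m + 1).choose α * (m + 1) * t := by
      calc N * t * (m + 1) ≤ (α * d + t) * B * (m + 1) := Nat.mul_le_mul_right _ h
        _ = B * (α * (d * (m + 1)) + t * (m + 1)) := by ring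
        _ ≤ B * (α * t + t * (m + 1)) := by gcongr
        _ = Fintype.card F ^ α * ((α + m + 1) * (α + m).choose α) * t := by rw [hB]; ring
        _ = _ := by rw [hch]; ring
    have h6 : N * (t * (m + 1)) ≤ (Fintype.card F ^ α * (α + m + 1).choose α) * (t * (m + 1)) := by
      calc _ = N * t * (m + 1) := by ring
        _ ≤ _ := h5
        _ = _ := by ring
    exact Nat.le_of_mul_le_mul_right h6 (by positivity)

lemma code_exists_puncture {F : Type} [Field F] [Fintype F] (n d : ℕ)
    (C : Submodule F (Fin n → F)) :
    ∃ T : Finset (Fin n), T.card ≤ Module.finrank F C * d ∧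
      ∀ E ≤ C.map (LinearMap.funLeft F F (Subtype.val : {i : Fin n // i ∉ T} → Fin n)),
        d * Module.finrank F E ≤ (codeSupp E).card := by
  classical
  obtain ⟨D, ⟨hDC, hDs⟩, hmax⟩ := Set.exists_max_image
    {D : Submodule F (Fin n → F) | D ≤ C ∧ (codeSupp D).card ≤ Module.finrank F D * d}
    (fun D => Module.finrank F D) (Set.toFinite _) ⟨⊥, bot_le, by simp [codeSupp]⟩
  refine ⟨codeSupp D, hDs.trans (Nat.mul_le_mul_right _ (Submodule.finrank_mono hDC)), ?_⟩
  intro E hE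
  by_contra hlt
  push Not at hlt
  set π := LinearMap.funLeft F F (Subtype.val : {i : Fin n // i ∉ codeSupp D} → Fin n) with hπ
  set P := C ⊓ E.comap π with hP
  have hmap : P.map π = E := by
    apply le_antisymm
    · rintro _ ⟨x, hx, rfl⟩
      exact hx.2
    · intro y hy
      obtain ⟨x, hx, rfl⟩ := hE hy
      exact ⟨x, ⟨hx, hy⟩, rfl⟩
  have hDπ : ∀ x ∈ D, π x = 0 := by
    intro x hx
    ext i
    have := i.2
    simp only [codeSupp, Finset.mem_filter, Finset.mem_univ, true_and, not_exists, not_and,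
      not_not] at this
    exact this x hx
  have hr := LinearMap.finrank_range_add_finrank_ker (π.domRestrict P)
  have hrange : LinearMap.range (π.domRestrict P) = E := by
    rw [LinearMap.range_domRestrict, hmap]
  rw [hrange] at hr
  have hker : Module.finrank F D ≤ Module.finrank F (LinearMap.ker (π.domRestrict P)) := by
    rw [← Submodule.finrank_map_subtype_eq P]
    apply Submodule.finrank_mono
    intro x hx
    have hxP : x ∈ P := ⟨hDC hx, by simp [hDπ x hx]⟩
    exact ⟨⟨x, hxP⟩, by simpa using hDπ x hx, rfl⟩
  have hsupp : (codeSupp P).card ≤ (codeSupp D).card + (codeSupp E).card := by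
    calc _ ≤ (codeSupp D ∪ (codeSupp E).image Subtype.val).card := by
          apply Finset.card_le_card
          intro i hi
          rw [Finset.mem_union]
          by_cases h : i ∈ codeSupp D
          · exact Or.inl h
          · right
            obtain ⟨c, hc, hci⟩ : ∃ c ∈ P, c i ≠ 0 := by simpa only [codeSupp, Finset.mem_filter, Finset.mem_univ, true_and] using hi
            rw [Finset.mem_image]
            refine ⟨⟨i, h⟩, ?_, rfl⟩
            exact mem_codeSupp.2 ⟨π c, hc.2, hci⟩
      _ ≤ _ := (Finset.card_union_le _ _).trans (Nat.add_le_add_left Finset.card_image_le _)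
  have := hmax P ⟨inf_le_left, by nlinarith⟩
  have h0 : Module.finrank F E = 0 := by omega
  rw [h0] at hlt
  omega


/-- For every linear code of dimension `k` over a field with `q` elements
and every `d ≥ 1`, there is a set `T` of at most `k·d` coordinates such that the code
punctured to the complement of `T` has at most `q^α · C(k,α)` codewords of weight `≤ α·d`,
for every `1 ≤ α ≤ k`. -/
theorem code_puncturing_counting_bound
    (F : Type) [Field F] [Fintype F] [DecidableEq F] (n k d : ℕ) (hd : 1 ≤ d)
    (𝒞 : Submodule F (Fin n → F)) (hdim : Module.finrank F 𝒞 = k) :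
    ∃ T : Finset (Fin n), T.card ≤ k * d ∧
      ∀ α : ℕ, 1 ≤ α → α ≤ k →
        {v : {i : Fin n // i ∉ T} → F |
            (∃ c ∈ 𝒞, ∀ i : {i : Fin n // i ∉ T}, v i = c i.1) ∧
            hammingNorm v ≤ α * d}.ncard
          ≤ Fintype.card F ^ α * k.choose α := by
  classical
  obtain ⟨T, hT, hE⟩ := code_exists_puncture n d 𝒞
  refine ⟨T, hdim ▸ hT, ?_⟩
  intro α hα hαk
  set π := LinearMap.funLeft F F (Subtype.val : {i : Fin n // i ∉ T} → Fin n) with hπ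
  have hset : {v : {i : Fin n // i ∉ T} → F |
            (∃ c ∈ 𝒞, ∀ i : {i : Fin n // i ∉ T}, v i = c i.1) ∧
            hammingNorm v ≤ α * d} = (codeLow (𝒞.map π) (α * d) : Set _) := by
    ext v
    simp only [codeLow, Set.mem_ofPred_eq, Finset.coe_filter, Finset.mem_univ, true_and,
      Submodule.mem_map]
    refine and_congr_left fun _ => exists_congr fun c => and_congr_right fun _ => ?_
    exact ⟨fun h => funext fun i => (h i).symm, fun h i => (congrFun h i).symm⟩
  rw [hset, Set.ncard_coe_finset]
  have hle : Module.finrank F (𝒞.map π) ≤ k := hdim ▸ Submodule.finrank_map_le π 𝒞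
  rcases le_total α (Module.finrank F (𝒞.map π)) with h | h
  · obtain ⟨m, hm⟩ := Nat.exists_eq_add_of_le h
    refine (codeLow_card_le d α m hd _ hm hE).trans ?_
    gcongr
    omega
  · have h1 : (codeLow (𝒞.map π) (α * d)).card ≤ Fintype.card (𝒞.map π) := by
      rw [Fintype.card_subtype]
      apply Finset.card_le_card
      intro x hx
      simp only [codeLow, Finset.mem_filter] at hx ⊢
      exact ⟨Finset.mem_univ _, hx.2.1⟩
    rw [Module.card_eq_pow_finrank (K := F) (V := 𝒞.map π)] at h1
    refine h1.trans ((Nat.pow_le_pow_right Fintype.card_pos h).trans ?_)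
    exact Nat.le_mul_of_pos_right _ (Nat.choose_pos hαk)
end

section
/- Let F be a finite field with q elements, let 𝒞 ⊆ F^n be a linear code of dimension k, and let d ≥ 1 be an integer. Then at least one of the following holds: (1) there exists a nonzero linear subcode 𝒞′ ⊆ 𝒞 with |Supp(𝒞′)| < d · dim(𝒞′) (i.e., the density dim(𝒞′)/|Supp(𝒞′)| exceeds 1/d); or (2) for every integer α with 1 ≤ α ≤ k, the number of codewords c ∈ 𝒞 with Hamming weight wt(c) ≤ α·d is at most q^α · binom(k, α). -/
open Classical in
/-- Contraction argument (Karger style), by induction on the codimension above `α`. -/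
lemma light_count_aux {F : Type} [Field F] [Fintype F] [DecidableEq F] {n : ℕ} (d α : ℕ)
    (hd : 1 ≤ d) (m : ℕ) : ∀ V : Submodule F (Fin n → F), Module.finrank F V = α + m →
    (∀ W : Submodule F (Fin n → F), W ≤ V → W ≠ ⊥ →
      d * Module.finrank F W ≤ (Finset.univ.filter fun i : Fin n => ∃ c ∈ W, c i ≠ 0).card) →
    (Finset.univ.filter fun c : Fin n → F => c ∈ V ∧ hammingNorm c ≤ α * d).card
      ≤ Fintype.card F ^ α * (α + m).choose α := by
  induction m with
  | zero =>
    intro V hV _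
    have h1 : (Finset.univ.filter fun c : Fin n → F => c ∈ V).card = Fintype.card F ^ α := by
      have h2 := Module.card_eq_pow_finrank (K := F) (V := V)
      rw [hV] at h2
      rw [add_zero] at h2
      rw [← Fintype.card_subtype, ← h2]
    simp only [add_zero, Nat.choose_self, mul_one]
    rw [← h1]
    apply Finset.card_le_card
    intro c
    simp +contextual
  | succ m ih =>
    intro V hV hP
    set S := Finset.univ.filter fun i : Fin n => ∃ c ∈ V, c i ≠ 0 with hS
    set L := Finset.univ.filter fun c : Fin n → F => c ∈ V ∧ hammingNorm c ≤ α * d with hL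
    have hbot : V ≠ ⊥ := by
      rintro rfl
      simp at hV
    have hSd : d * (α + (m + 1)) ≤ S.card := hV ▸ hP V le_rfl hbot
    have key : ∀ i ∈ S, (L.filter fun c => c i = 0).card
        ≤ Fintype.card F ^ α * (α + m).choose α := by
      intro i hi
      obtain ⟨c, hc, hci⟩ := (Finset.mem_filter.mp hi).2
      let f : Module.Dual F V := (LinearMap.proj i : (Fin n → F) →ₗ[F] F).domRestrict V
      have hf : f ≠ 0 := by
        intro h0
        exact hci (by simpa [f] using LinearMap.congr_fun h0 ⟨c, hc⟩)
      have hk := Module.Dual.finrank_ker_add_one_of_ne_zero hf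
      have hle : (LinearMap.ker f).map V.subtype ≤ V := Submodule.map_subtype_le _ _
      have hmem : ∀ x, x ∈ (LinearMap.ker f).map V.subtype ↔ x ∈ V ∧ x i = 0 := by
        intro x
        simp [f, and_comm]
      have h3 := ih ((LinearMap.ker f).map V.subtype)
        (by rw [Submodule.finrank_map_subtype_eq]; omega)
        (fun W hW hW0 => hP W (hW.trans hle) hW0)
      refine le_trans (Finset.card_le_card ?_) h3
      intro x hx
      simp only [hL, Finset.mem_filter, Finset.mem_univ, true_and] at hx ⊢
      exact ⟨(hmem x).2 ⟨hx.1.1, hx.2⟩, hx.1.2⟩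
    have dc : ∑ i ∈ S, (L.filter fun c => c i = 0).card
        = ∑ c ∈ L, (S.filter fun i => c i = 0).card :=
      Finset.sum_card_bipartiteAbove_eq_sum_card_bipartiteBelow
        (s := S) (t := L) (fun (i : Fin n) (c : Fin n → F) => c i = 0)
    have up := Finset.sum_le_card_nsmul S _ _ key
    have low : L.card • (S.card - α * d) ≤ ∑ c ∈ L, (S.filter fun i => c i = 0).card := by
      apply Finset.card_nsmul_le_sum
      intro c hc
      have hw := (Finset.mem_filter.mp hc).2.2
      have h4 := Finset.card_filter_add_card_filter_not (s := S) (fun i => c i = 0)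
      have h5 : (S.filter fun i => ¬ c i = 0).card ≤ hammingNorm c :=
        Finset.card_le_card (Finset.filter_subset_filter _ (Finset.subset_univ S))
      omega
    rw [dc] at up
    have h6 := low.trans up
    simp only [smul_eq_mul] at h6
    have hch := Nat.choose_mul_succ_eq (α + m) α
    have h7 : α + m + 1 - α = m + 1 := by omega
    rw [h7] at hch
    obtain ⟨t, ht⟩ : ∃ t, S.card = α * d + t := by
      refine Nat.exists_eq_add_of_le (le_trans ?_ hSd)
      nlinarith
    rw [ht] at h6 hSd
    rw [Nat.add_sub_cancel_left] at h6
    have h8 : d * (m + 1) ≤ t := by nlinarith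
    have htp : 0 < t := lt_of_lt_of_le (by positivity) h8
    -- (αd + t)(m+1) ≤ t (α+m+1)
    have h9 : (α * d + t) * (m + 1) ≤ t * (α + m + 1) := by
      nlinarith [Nat.mul_le_mul_left α h8]
    have h10 : (L.card * t) * (m + 1)
        ≤ (Fintype.card F ^ α * (α + m + 1).choose α * t) * (m + 1) := by
      calc (L.card * t) * (m + 1)
          ≤ ((α * d + t) * (Fintype.card F ^ α * (α + m).choose α)) * (m + 1) :=
            Nat.mul_le_mul_right _ h6
        _ = ((α * d + t) * (m + 1)) * (Fintype.card F ^ α * (α + m).choose α) := by ring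
        _ ≤ (t * (α + m + 1)) * (Fintype.card F ^ α * (α + m).choose α) :=
            Nat.mul_le_mul_right _ h9
        _ = t * Fintype.card F ^ α * ((α + m).choose α * (α + m + 1)) := by ring
        _ = _ := by rw [hch]; ring
    exact Nat.le_of_mul_le_mul_right (Nat.le_of_mul_le_mul_right h10 (Nat.succ_pos m)) htp


/-- For every linear code `𝒞` of dimension `k` over a field with `q` elements
and every `d ≥ 1`, either `𝒞` contains a nonzero subcode of density exceeding `1/d`
(support size `< d · dim`), or for every `1 ≤ α ≤ k` the number of codewords of Hamming
weight `≤ α·d` is at most `q^α · C(k,α)`. -/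
theorem code_density_or_counting
    (F : Type) [Field F] [Fintype F] [DecidableEq F] (n k d : ℕ) (hd : 1 ≤ d)
    (𝒞 : Submodule F (Fin n → F)) (hdim : Module.finrank F 𝒞 = k) :
    (∃ 𝒞' : Submodule F (Fin n → F), 𝒞' ≤ 𝒞 ∧ 𝒞' ≠ ⊥ ∧
        {i : Fin n | ∃ c ∈ 𝒞', c i ≠ 0}.ncard < d * Module.finrank F 𝒞') ∨
    (∀ α : ℕ, 1 ≤ α → α ≤ k →
        {c : Fin n → F | c ∈ 𝒞 ∧ hammingNorm c ≤ α * d}.ncard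
          ≤ Fintype.card F ^ α * k.choose α) := by
  classical
  by_cases h : ∃ 𝒞' : Submodule F (Fin n → F), 𝒞' ≤ 𝒞 ∧ 𝒞' ≠ ⊥ ∧
        {i : Fin n | ∃ c ∈ 𝒞', c i ≠ 0}.ncard < d * Module.finrank F 𝒞'
  · exact Or.inl h
  · right
    intro α _ hk
    push Not at h
    obtain ⟨m, rfl⟩ := Nat.exists_eq_add_of_le hk
    have := light_count_aux d α hd m 𝒞 hdim (by
      intro W hW hW0
      have := h W hW hW0
      rw [← Set.ncard_coe_finset]
      simpa using this)
    rw [← Set.ncard_coe_finset] at this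
    simpa using this
end

section
/- There is an absolute constant C₀ > 0 with the following property. Let F be a finite field with q elements, let ε ∈ (0,1), and let 𝒞 ⊆ F^n be a linear code of dimension k ≥ 1. Then there exists a subset S ⊆ {1,…,n} with |S| ≤ C₀ · k² · log(q) / ε², together with nonnegative real weights (w_i)_{i∈S}, such that for every codeword c ∈ 𝒞 one has (1−ε)·wt(c) ≤ Σ_{i∈S : c_i≠0} w_i ≤ (1+ε)·wt(c). -/
/-- Sensitivities of a code have total at most the dimension. -/
theorem code_sensitivity (F : Type) [Field F] [Fintype F] [DecidableEq F] (n : ℕ) :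
    ∀ (k : ℕ) (C : Submodule F (Fin n → F)), Module.finrank F C ≤ k →
      ∃ s : Fin n → ℝ, (∀ i, 0 ≤ s i) ∧ ∑ i, s i ≤ k ∧
        ∀ c ∈ C, ∀ i, c i ≠ 0 → 1 ≤ s i * (hammingNorm c : ℝ) := by
  intro k
  induction k with
  | zero =>
    intro C hC
    refine ⟨fun _ => 0, fun _ => le_rfl, by simp, ?_⟩
    intro c hc i hi
    have h0 : C = ⊥ := Submodule.finrank_eq_zero.mp (Nat.le_zero.mp hC)
    rw [h0, Submodule.mem_bot] at hc
    simp [hc] at hi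
  | succ k ih =>
    intro C hC
    by_cases hbot : C = ⊥
    · refine ⟨fun _ => 0, fun _ => le_rfl, by simp; positivity, ?_⟩
      intro c hc i hi
      rw [hbot, Submodule.mem_bot] at hc
      simp [hc] at hi
    obtain ⟨b, hb, hb0⟩ := Submodule.exists_mem_ne_zero_of_ne_bot hbot
    classical
    obtain ⟨c₁, hc₁, hmin⟩ := Finset.exists_min_image
      (Finset.univ.filter (fun c : Fin n → F => c ∈ C ∧ c ≠ 0)) (fun c => hammingNorm c)
      ⟨b, by simp [hb, hb0]⟩
    simp only [Finset.mem_filter, Finset.mem_univ, true_and] at hc₁ hmin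
    let P : (Fin n → F) →ₗ[F] (Fin n → F) :=
      { toFun := fun c i => if c₁ i ≠ 0 then 0 else c i
        map_add' := by intro x y; ext i; by_cases h : c₁ i = 0 <;> simp [h]
        map_smul' := by intro a x; ext i; by_cases h : c₁ i = 0 <;> simp [h] }
    have hP : ∀ c i, P c i = if c₁ i ≠ 0 then 0 else c i := fun _ _ => rfl
    have hdim : Module.finrank F (C.map P) ≤ k := by
      have h1 := LinearMap.finrank_range_add_finrank_ker (P.domRestrict C)
      have h2 : LinearMap.range (P.domRestrict C) = C.map P := by
        rw [LinearMap.range_domRestrict]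
      rw [h2] at h1
      have h3 : 0 < Module.finrank F (LinearMap.ker (P.domRestrict C)) := by
        refine (Module.finrank_pos_iff_exists_ne_zero (R := F)
          (M := LinearMap.ker (P.domRestrict C))).mpr ?_
        refine ⟨⟨⟨c₁, hc₁.1⟩, ?_⟩, ?_⟩
        · rw [LinearMap.mem_ker, LinearMap.domRestrict_apply]
          ext i
          rw [hP]
          by_cases h : c₁ i = 0 <;> simp [h]
        · intro h
          apply hc₁.2
          exact congrArg (fun x : LinearMap.ker (P.domRestrict C) => ((x : C) : Fin n → F)) h
      omega
    obtain ⟨s, hs0, hsum, hs⟩ := ih (C.map P) hdim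
    have hpos : 0 < (hammingNorm c₁ : ℝ) := by
      exact_mod_cast hammingNorm_pos_iff.mpr hc₁.2
    refine ⟨fun i => if c₁ i ≠ 0 then 1 / (hammingNorm c₁ : ℝ) else s i, ?_, ?_, ?_⟩
    · intro i
      dsimp only
      split_ifs
      · positivity
      · exact hs0 i
    · calc ∑ i, (if c₁ i ≠ 0 then 1 / (hammingNorm c₁ : ℝ) else s i)
          ≤ ∑ i, ((if c₁ i ≠ 0 then 1 / (hammingNorm c₁ : ℝ) else 0) + s i) := by
            apply Finset.sum_le_sum
            intro i _
            have := hs0 i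
            split_ifs <;> linarith
        _ = 1 + ∑ i, s i := by
            rw [Finset.sum_add_distrib, ← Finset.sum_filter, Finset.sum_const, nsmul_eq_mul]
            have : ((Finset.univ.filter (fun i => c₁ i ≠ 0)).card : ℝ) = hammingNorm c₁ := rfl
            rw [this, mul_one_div_cancel hpos.ne']
        _ ≤ _ := by push_cast; linarith
    · intro c hc i hi
      dsimp only
      split_ifs with h
      · have hc0 : c ≠ 0 := by rintro rfl; simp at hi
        have := hmin c ⟨hc, hc0⟩
        rw [one_div_mul_eq_div, le_div_iff₀ hpos, one_mul]
        exact_mod_cast this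
      · have h1 := hs (P c) (Submodule.mem_map_of_mem hc) i (by rw [hP]; simpa [h] using hi)
        have h2 : hammingNorm (P c) ≤ hammingNorm c := by
          apply Finset.card_le_card
          intro j
          simp only [Finset.mem_filter, Finset.mem_univ, true_and, hP]
          intro hj
          by_cases h : c₁ j = 0 <;> simp_all
        refine h1.trans (mul_le_mul_of_nonneg_left ?_ (hs0 i))
        exact_mod_cast h2

/-- Moment generating function bound. -/
theorem mgf_bound {ι : Type} [Fintype ι] (p Z : ι → ℝ) (hp : ∀ i, 0 ≤ p i)
    (hp1 : ∑ i, p i = 1) (hZ0 : ∀ i, 0 ≤ Z i) (hZ1 : ∀ i, Z i ≤ 1) (l : ℝ) (hl : |l| ≤ 1) :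
    ∑ i, p i * Real.exp (l * Z i) ≤ Real.exp ((l + l ^ 2) * ∑ i, p i * Z i) := by
  have hel : Real.exp l - 1 ≤ l + l ^ 2 := by
    have := (abs_le.mp (Real.abs_exp_sub_one_sub_id_le hl)).2
    linarith
  have hpt : ∀ z : ℝ, 0 ≤ z → z ≤ 1 → Real.exp (l * z) ≤ 1 + (l + l ^ 2) * z := by
    intro z h0 h1
    have := convexOn_exp.2 (Set.mem_univ (0 : ℝ)) (Set.mem_univ l)
      (by linarith : 0 ≤ 1 - z) h0 (by ring)
    simp only [smul_eq_mul, mul_zero, zero_add, Real.exp_zero, mul_one] at this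
    rw [mul_comm l z]
    nlinarith
  calc ∑ i, p i * Real.exp (l * Z i) ≤ ∑ i, (p i + (l + l ^ 2) * (p i * Z i)) := by
        apply Finset.sum_le_sum
        intro i _
        have := mul_le_mul_of_nonneg_left (hpt (Z i) (hZ0 i) (hZ1 i)) (hp i)
        linarith
    _ = (l + l ^ 2) * (∑ i, p i * Z i) + 1 := by
        rw [Finset.sum_add_distrib, ← Finset.mul_sum, hp1, add_comm]
    _ ≤ _ := Real.add_one_le_exp _

theorem sampling {ι A : Type} [Fintype ι] [DecidableEq ι] [Fintype A] (p : ι → ℝ)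
    (hp : ∀ i, 0 ≤ p i)
    (hp1 : ∑ i, p i = 1) (Z : A → ι → ℝ) (hZ0 : ∀ a i, 0 ≤ Z a i) (hZ1 : ∀ a i, Z a i ≤ 1)
    (μ : ℝ) (hμ : ∀ a, ∑ i, p i * Z a i = μ) (ε : ℝ) (hε0 : 0 < ε) (hε1 : ε < 1)
    (m : ℕ) (hm : 2 * (Fintype.card A : ℝ) * Real.exp (-(ε ^ 2 * m * μ / 4)) < 1) :
    ∃ f : Fin m → ι, ∀ a, (1 - ε) * (m * μ) ≤ ∑ t, Z a (f t) ∧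
      ∑ t, Z a (f t) ≤ (1 + ε) * (m * μ) := by
  have hfac : ∀ g : ι → ℝ, ∑ f : Fin m → ι, ∏ t, g (f t) = (∑ i, g i) ^ m := by
    intro g
    have := Finset.prod_univ_sum (fun _ : Fin m => (Finset.univ : Finset ι)) (fun _ i => g i)
    simp only [Fintype.piFinset_univ, Finset.prod_const, Finset.card_univ,
      Fintype.card_fin] at this
    exact this.symm
  have hmgf : ∀ a (l : ℝ), |l| ≤ 1 → ∑ f : Fin m → ι, (∏ t, p (f t)) *
      Real.exp (l * ∑ t, Z a (f t)) ≤ Real.exp ((l + l ^ 2) * (m * μ)) := by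
    intro a l hl
    have h1 : ∀ f : Fin m → ι, (∏ t, p (f t)) * Real.exp (l * ∑ t, Z a (f t)) =
        ∏ t, (p (f t) * Real.exp (l * Z a (f t))) := by
      intro f
      rw [Finset.prod_mul_distrib, Finset.mul_sum, Real.exp_sum]
    simp_rw [h1]
    rw [hfac (fun i => p i * Real.exp (l * Z a i))]
    have h2 := mgf_bound p (Z a) hp hp1 (hZ0 a) (hZ1 a) l hl
    rw [hμ] at h2
    calc _ ≤ Real.exp ((l + l ^ 2) * μ) ^ m :=
          pow_le_pow_left₀ (Finset.sum_nonneg fun i _ =>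
            mul_nonneg (hp i) (Real.exp_pos _).le) h2 m
      _ = _ := by rw [← Real.exp_nat_mul]; congr 1; ring
  let U : A → (Fin m → ι) → ℝ := fun a f =>
    Real.exp (ε / 2 * ∑ t, Z a (f t)) * Real.exp (-(ε / 2 * ((1 + ε) * (m * μ))))
    + Real.exp (-(ε / 2) * ∑ t, Z a (f t)) * Real.exp (ε / 2 * ((1 - ε) * (m * μ)))
  have hU : ∀ a, ∑ f : Fin m → ι, (∏ t, p (f t)) * U a f
      ≤ 2 * Real.exp (-(ε ^ 2 * m * μ / 4)) := by
    intro a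
    have hsplit : ∀ x a b c d : ℝ, x * (a * b + c * d) = x * a * b + x * c * d := by
      intros; ring
    simp only [U, hsplit]
    rw [Finset.sum_add_distrib, ← Finset.sum_mul, ← Finset.sum_mul]
    have h1 := hmgf a (ε / 2) (by rw [abs_le]; constructor <;> linarith)
    have h2 := hmgf a (-(ε / 2)) (by rw [abs_le]; constructor <;> linarith)
    have h3 := mul_le_mul_of_nonneg_right h1
      (Real.exp_pos (-(ε / 2 * ((1 + ε) * (m * μ))))).le
    have h4 := mul_le_mul_of_nonneg_right h2
      (Real.exp_pos (ε / 2 * ((1 - ε) * (m * μ)))).le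
    rw [← Real.exp_add] at h3 h4
    have e3 : (ε / 2 + (ε / 2) ^ 2) * (m * μ) + -(ε / 2 * ((1 + ε) * (m * μ)))
      = -(ε ^ 2 * m * μ / 4) := by ring
    have e4 : (-(ε / 2) + (-(ε / 2)) ^ 2) * (m * μ) + ε / 2 * ((1 - ε) * (m * μ))
      = -(ε ^ 2 * m * μ / 4) := by ring
    rw [e3] at h3
    rw [e4] at h4
    linarith
  have hex : ∃ f : Fin m → ι, ∑ a, U a f < 1 := by
    by_contra hcon
    push Not at hcon
    have h1 : (1 : ℝ) ≤ ∑ f : Fin m → ι, (∏ t, p (f t)) * ∑ a, U a f := by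
      calc (1 : ℝ) = ∑ f : Fin m → ι, (∏ t, p (f t)) := by rw [hfac, hp1, one_pow]
        _ ≤ _ := Finset.sum_le_sum fun f _ =>
          le_mul_of_one_le_right (Finset.prod_nonneg fun t _ => hp _) (hcon f)
    have h2 : ∑ f : Fin m → ι, (∏ t, p (f t)) * ∑ a, U a f
        = ∑ a, ∑ f : Fin m → ι, (∏ t, p (f t)) * U a f := by
      simp_rw [Finset.mul_sum]
      rw [Finset.sum_comm]
    have h3 : ∑ a, ∑ f : Fin m → ι, (∏ t, p (f t)) * U a f
        ≤ ∑ a : A, 2 * Real.exp (-(ε ^ 2 * m * μ / 4)) := Finset.sum_le_sum fun a _ => hU a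
    rw [Finset.sum_const, nsmul_eq_mul, Finset.card_univ] at h3
    linarith
  obtain ⟨f, hf⟩ := hex
  refine ⟨f, fun a => ?_⟩
  have hUa : U a f < 1 := lt_of_le_of_lt
    (Finset.single_le_sum (f := fun a => U a f)
      (fun b _ => by simp only [U]; positivity) (Finset.mem_univ a)) hf
  simp only [U, ← Real.exp_add] at hUa
  have p1 := Real.exp_pos (ε / 2 * ∑ t, Z a (f t) + -(ε / 2 * ((1 + ε) * (m * μ))))
  have p2 := Real.exp_pos (-(ε / 2) * ∑ t, Z a (f t) + ε / 2 * ((1 - ε) * (m * μ)))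
  have q1 := Real.exp_lt_one_iff.mp (by linarith :
    Real.exp (ε / 2 * ∑ t, Z a (f t) + -(ε / 2 * ((1 + ε) * (m * μ)))) < 1)
  have q2 := Real.exp_lt_one_iff.mp (by linarith :
    Real.exp (-(ε / 2) * ∑ t, Z a (f t) + ε / 2 * ((1 - ε) * (m * μ))) < 1)
  constructor
  · refine le_of_mul_le_mul_left ?_ (half_pos hε0)
    linarith
  · refine le_of_mul_le_mul_left ?_ (half_pos hε0)
    linarith

/-- Every linear code of dimension `k ≥ 1` over a field with `q` elements
has a `(1 ± ε)`-sparsifier of size `C₀ · k² · log q / ε²`. -/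
theorem quadratic_code_sparsification :
    ∃ C₀ : ℝ, 0 < C₀ ∧
      ∀ (F : Type) [Field F] [Fintype F] [DecidableEq F] (n k : ℕ), 1 ≤ k →
        ∀ ε : ℝ, ε ∈ Set.Ioo (0 : ℝ) 1 →
          ∀ (𝒞 : Submodule F (Fin n → F)), Module.finrank F 𝒞 = k →
            ∃ (S : Finset (Fin n)) (w : Fin n → ℝ),
              (∀ i, 0 ≤ w i) ∧
              (S.card : ℝ) ≤ C₀ * (k : ℝ) ^ 2 * Real.log (Fintype.card F) / ε ^ 2 ∧
              ∀ c : Fin n → F, c ∈ 𝒞 →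
                (1 - ε) * (hammingNorm c : ℝ) ≤ (∑ i ∈ S.filter (fun i => c i ≠ 0), w i) ∧
                  (∑ i ∈ S.filter (fun i => c i ≠ 0), w i) ≤ (1 + ε) * (hammingNorm c : ℝ) := by
  refine ⟨10, by norm_num, ?_⟩
  intro F _ _ _ n k hk ε hε C hC
  obtain ⟨hε0, hε1⟩ := hε
  classical
  obtain ⟨s', hs'0, hs'sum, hs'⟩ := code_sensitivity F n k C hC.le
  have hn : 0 < n := by
    have := Submodule.finrank_le C
    simp only [Module.finrank_fin_fun] at this
    omega
  have hnR : (0 : ℝ) < n := by exact_mod_cast hn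
  have hkR : (1 : ℝ) ≤ k := by exact_mod_cast hk
  have hk0 : (0 : ℝ) < k := by linarith
  obtain ⟨s, hs0, hsum, hs⟩ : ∃ s : Fin n → ℝ, (∀ i, 0 ≤ s i) ∧ ∑ i, s i = k ∧
        ∀ c ∈ C, ∀ i, c i ≠ 0 → 1 ≤ s i * (hammingNorm c : ℝ) := by
    have hd : 0 ≤ ((k : ℝ) - ∑ i, s' i) / n := div_nonneg (by linarith) hnR.le
    refine ⟨fun i => s' i + ((k : ℝ) - ∑ i, s' i) / n, fun i => add_nonneg (hs'0 i) hd, ?_, ?_⟩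
    · rw [Finset.sum_add_distrib, Finset.sum_const, nsmul_eq_mul, Finset.card_univ,
        Fintype.card_fin, mul_div_cancel₀ _ hnR.ne']
      ring
    · intro c hc i hi
      refine (hs' c hc i hi).trans (mul_le_mul_of_nonneg_right ?_ (Nat.cast_nonneg _))
      linarith
  have hq : (2 : ℝ) ≤ Fintype.card F := by exact_mod_cast Fintype.one_lt_card (α := F)
  have hlog : Real.log 2 ≤ Real.log (Fintype.card F) := Real.log_le_log (by norm_num) hq
  have hlog2 := Real.log_two_gt_d9
  set L := Real.log (Fintype.card F) with hL
  obtain ⟨m, hm⟩ : ∃ m : ℕ, m = ⌊8 * (k : ℝ) ^ 2 * L / ε ^ 2⌋₊ + 1 := ⟨_, rfl⟩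
  have hLpos : 0 < L := by linarith
  have hmgt : 8 * (k : ℝ) ^ 2 * L / ε ^ 2 < m := by
    rw [hm]; push_cast; exact Nat.lt_floor_add_one _
  have hmle : (m : ℝ) ≤ 10 * (k : ℝ) ^ 2 * L / ε ^ 2 := by
    have h1 : (m : ℝ) ≤ 8 * (k : ℝ) ^ 2 * L / ε ^ 2 + 1 := by
      rw [hm]; push_cast
      have := Nat.floor_le (by positivity : 0 ≤ 8 * (k : ℝ) ^ 2 * L / ε ^ 2)
      linarith
    have h2 : 1 ≤ 2 * (k : ℝ) ^ 2 * L / ε ^ 2 := by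
      rw [le_div_iff₀ (by positivity)]
      have a1 : ε ^ 2 ≤ 1 := pow_le_one₀ hε0.le hε1.le
      have a2 : (1 : ℝ) ≤ (k : ℝ) ^ 2 := one_le_pow₀ hkR
      nlinarith
    have h3 : 10 * (k : ℝ) ^ 2 * L / ε ^ 2
      = 8 * (k : ℝ) ^ 2 * L / ε ^ 2 + 2 * (k : ℝ) ^ 2 * L / ε ^ 2 := by ring
    linarith
  have hm0 : (0 : ℝ) < m := lt_of_le_of_lt (by positivity) hmgt
  have hspos : ∀ c ∈ C, ∀ i, c i ≠ 0 → 0 < s i := by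
    intro c hc i hi
    rcases (hs0 i).eq_or_lt with h | h
    · have := hs c hc i hi
      rw [← h] at this
      norm_num at this
    · exact h
  let A := {c : C // c ≠ 0}
  have hwt : ∀ a : A, (0 : ℝ) < hammingNorm (a.1 : Fin n → F) := by
    intro a
    have : (a.1 : Fin n → F) ≠ 0 := by
      intro h; exact a.2 (Subtype.ext h)
    exact_mod_cast hammingNorm_pos_iff.mpr this
  let Z : A → Fin n → ℝ := fun a i =>
    if (a.1 : Fin n → F) i ≠ 0 then 1 / (s i * hammingNorm (a.1 : Fin n → F)) else 0
  have hcard : (Fintype.card A : ℝ) ≤ Real.exp (k * L) := by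
    have h1 : Fintype.card A ≤ Fintype.card C := Fintype.card_subtype_le _
    rw [Module.card_eq_pow_finrank (K := F) (V := C), hC] at h1
    have h2 : Real.exp (k * L) = (Fintype.card F : ℝ) ^ k := by
      rw [Real.exp_nat_mul, hL, Real.exp_log (by linarith)]
    rw [h2]
    exact_mod_cast h1
  obtain ⟨f, hf⟩ := sampling (fun i => s i / k) (fun i => div_nonneg (hs0 i) hk0.le)
    (by rw [← Finset.sum_div, hsum, div_self hk0.ne']) Z
    (by
      intro a i
      simp only [Z]
      split_ifs
      · have := hs0 i; positivity
      · exact le_rfl)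
    (by
      intro a i
      simp only [Z]
      split_ifs with h
      · have := hs a.1 a.1.2 i h
        exact (div_le_one (by linarith)).mpr this
      · norm_num)
    (1 / k)
    (by
      intro a
      have h1 : ∀ i, s i / k * Z a i = if (a.1 : Fin n → F) i ≠ 0 then
          1 / (k * (hammingNorm (a.1 : Fin n → F) : ℝ)) else 0 := by
        intro i
        simp only [Z]
        split_ifs with h
        · have h2 := hspos a.1 a.1.2 i h
          have h3 := hwt a
          field_simp
        · simp
      simp_rw [h1]
      rw [← Finset.sum_filter, Finset.sum_const, nsmul_eq_mul]
      have : ((Finset.univ.filter (fun i => (a.1 : Fin n → F) i ≠ 0)).card : ℝ)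
        = hammingNorm (a.1 : Fin n → F) := rfl
      rw [this]
      have h3 := hwt a
      field_simp)
    ε hε0 hε1 m
    (by
      have h1 : 2 * (k : ℝ) * L < ε ^ 2 * m * (1 / k) / 4 := by
        rw [div_lt_iff₀ (by positivity)] at hmgt
        rw [lt_div_iff₀ (by norm_num), mul_one_div, lt_div_iff₀ hk0]
        nlinarith
      have h2 : Real.exp (-(ε ^ 2 * m * (1 / k) / 4)) < Real.exp (-(2 * (k : ℝ) * L)) :=
        Real.exp_lt_exp.mpr (by linarith)
      have h3 : (2 : ℝ) ≤ Real.exp (k * L) := by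
        have : Real.exp (Real.log 2) ≤ Real.exp (k * L) :=
          Real.exp_le_exp.mpr (by nlinarith)
        rwa [Real.exp_log (by norm_num)] at this
      have h4 : Real.exp (k * L) * Real.exp (k * L) * Real.exp (-(2 * (k : ℝ) * L)) = 1 := by
        rw [← Real.exp_add, ← Real.exp_add, ← Real.exp_zero]; congr 1; ring
      have h5 : 2 * (Fintype.card A : ℝ) ≤ Real.exp (k * L) * Real.exp (k * L) :=
        mul_le_mul h3 hcard (Nat.cast_nonneg _) (Real.exp_pos _).le
      calc _ ≤ Real.exp (k * L) * Real.exp (k * L) *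
            Real.exp (-(ε ^ 2 * m * (1 / k) / 4)) :=
            mul_le_mul_of_nonneg_right h5 (Real.exp_pos _).le
        _ < _ := mul_lt_mul_of_pos_left h2 (by positivity)
        _ = 1 := h4)
  refine ⟨Finset.univ.image f, fun i => ∑ t, if f t = i then k / (m * s i) else 0, ?_, ?_, ?_⟩
  · intro i
    apply Finset.sum_nonneg
    intro t _
    have := hs0 i
    split_ifs
    · positivity
    · exact le_rfl
  · refine le_trans ?_ hmle
    have := Finset.card_image_le (s := (Finset.univ : Finset (Fin m))) (f := f)
    rw [Finset.card_univ, Fintype.card_fin] at this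
    exact_mod_cast this
  · intro c hc
    by_cases hc0 : c = 0
    · subst hc0; simp
    let a : A := ⟨⟨c, hc⟩, fun h => hc0 (congrArg Subtype.val h)⟩
    have hw := hwt a
    have key : (∑ i ∈ (Finset.univ.image f).filter (fun i => c i ≠ 0),
        ∑ t, if f t = i then k / (m * s i) else 0)
        = (k * hammingNorm c / m) * ∑ t, Z a (f t) := by
      rw [Finset.sum_comm, Finset.mul_sum]
      apply Finset.sum_congr rfl
      intro t _
      rw [Finset.sum_ite_eq]
      simp only [Finset.mem_filter, Finset.mem_image, Finset.mem_univ, true_and,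
        exists_apply_eq_apply, Z, a]
      split_ifs with h
      · have h2 := hspos c hc (f t) h
        have h3 : (0 : ℝ) < hammingNorm c := hw
        field_simp
      · simp
    rw [key]
    have h3 : (0 : ℝ) < hammingNorm c := hw
    have hpos : 0 < (k * hammingNorm c / m : ℝ) := by positivity
    obtain ⟨l, u⟩ := hf a
    have l' := mul_le_mul_of_nonneg_left l hpos.le
    have u' := mul_le_mul_of_nonneg_left u hpos.le
    have e : ∀ x : ℝ, (k * hammingNorm c / m : ℝ) * (x * (m * (1 / k))) = x * hammingNorm c := by
      intro x; field_simp
    rw [e] at l' u'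
    exact ⟨l', u'⟩
end

section
/- Let F be a finite field and let 𝒞 ⊆ F^n be a linear code of dimension k. Then there exists a basis b_1,…,b_k of 𝒞 such that every codeword c ∈ 𝒞 is an F-linear combination of those basis vectors b_i satisfying wt(b_i) ≤ wt(c); that is, c lies in the span of {b_i : wt(b_i) ≤ wt(c)}. -/
theorem weight_sorted_aux
    (F : Type) [Field F] [DecidableEq F] (n : ℕ)
    (C : Submodule F (Fin n → F)) (w : ℕ) :
    ∃ S : Set (Fin n → F), (∀ x ∈ S, x ∈ C ∧ hammingNorm x ≤ w) ∧
      LinearIndepOn F id S ∧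
      ∀ c ∈ C, hammingNorm c ≤ w →
        c ∈ Submodule.span F {x | x ∈ S ∧ hammingNorm x ≤ hammingNorm c} := by
  induction w with
  | zero =>
    refine ⟨∅, by simp, linearIndepOn_empty _ _, ?_⟩
    intro c _ hc
    have h0 : c = 0 := hammingNorm_eq_zero.mp (Nat.le_zero.mp hc)
    rw [h0]
    exact Submodule.zero_mem _
  | succ w ih =>
    obtain ⟨S, hS, hli, hsp⟩ := ih
    obtain ⟨S', hS't, hSS', htS', hli'⟩ := exists_linearIndepOn_id_extension hli
      (t := {x | x ∈ C ∧ hammingNorm x ≤ w + 1})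
      (fun x hx => ⟨(hS x hx).1, (hS x hx).2.trans (Nat.le_succ w)⟩)
    refine ⟨S', fun x hx => hS't hx, hli', ?_⟩
    intro c hcC hc
    rcases Nat.lt_or_ge w (hammingNorm c) with h | h
    · have hmem : c ∈ Submodule.span F S' := htS' (show _ ∧ _ from ⟨hcC, hc⟩)
      refine Submodule.span_mono ?_ hmem
      intro x hx
      exact ⟨hx, (hS't hx).2.trans h⟩
    · refine Submodule.span_mono ?_ (hsp c hcC h)
      intro x hx
      exact ⟨hSS' hx.1, hx.2⟩

/-- Every linear code `𝒞` of dimension `k` has a basis `b₁,…,b_k` such that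
every codeword `c ∈ 𝒞` lies in the span of those basis vectors of Hamming weight at most
`wt(c)`. -/
theorem exists_weight_sorted_basis
    (F : Type) [Field F] [Fintype F] [DecidableEq F] (n k : ℕ)
    (𝒞 : Submodule F (Fin n → F)) (hdim : Module.finrank F 𝒞 = k) :
    ∃ b : Fin k → (Fin n → F),
      (∀ i, b i ∈ 𝒞) ∧
      LinearIndependent F b ∧
      Submodule.span F (Set.range b) = 𝒞 ∧
      ∀ c : Fin n → F, c ∈ 𝒞 →
        c ∈ Submodule.span F (b '' {i : Fin k | hammingNorm (b i) ≤ hammingNorm c}) := by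
  obtain ⟨S, hS, hli, hsp⟩ := weight_sorted_aux F n 𝒞 n
  have hle : ∀ c : Fin n → F, hammingNorm c ≤ n := fun c => by
    simpa using hammingNorm_le_card_fintype (x := c)
  have hspan : Submodule.span F S = 𝒞 := by
    apply le_antisymm
    · exact Submodule.span_le.mpr (fun x hx => (hS x hx).1)
    · intro c hc
      exact Submodule.span_mono (fun x hx => hx.1) (hsp c hc (hle c))
  have hcard : Nat.card S = k := by
    rw [← hdim, ← hspan]
    have : Fintype S := Fintype.ofFinite S
    rw [finrank_span_set_eq_card hli, Set.toFinset_card, Nat.card_eq_fintype_card]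
  let e : Fin k ≃ S := (Finite.equivFinOfCardEq hcard).symm
  have hr : Set.range (fun i => (e i : Fin n → F)) = S := by
    ext x
    constructor
    · rintro ⟨i, rfl⟩
      exact (e i).2
    · intro hx
      exact ⟨e.symm ⟨x, hx⟩, by simp⟩
  refine ⟨fun i => (e i : Fin n → F), fun i => (hS _ (e i).2).1, ?_, ?_, ?_⟩
  · exact LinearIndependent.comp hli e e.injective
  · rw [hr, hspan]
  · intro c hc
    refine Submodule.span_mono ?_ (hsp c hc (hle c))
    rintro x ⟨hx, hw⟩
    exact ⟨e.symm ⟨x, hx⟩, by simpa using hw, by simp⟩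
end

section
/- Let F be a finite field and let A be an n × k matrix over F with columns A_1,…,A_k. For each row index i ∈ {1,…,n}, define m_i = max{1/wt(A_j) : j ∈ {1,…,k}, A_{i,j} ≠ 0} (as a nonnegative rational number), with m_i = 0 if no column of A is nonzero in row i; here wt(A_j) denotes the Hamming weight (number of nonzero entries) of column A_j. Then Σ_{i=1}^n m_i ≤ k. -/
/-- For an `n × k` matrix `A` over a finite field, summing over rows `i`
the maximum of `1/wt(A_j)` over columns `j` that are nonzero in row `i` (taking `0` if
no column is nonzero in row `i`) gives at most `k`. -/
theorem matrix_reciprocal_column_weight_sum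
    (F : Type) [Field F] [DecidableEq F] (n k : ℕ) (A : Matrix (Fin n) (Fin k) F) :
    ∑ i : Fin n,
        (Finset.univ.filter (fun j : Fin k => A i j ≠ 0)).sup
          (fun j => ((hammingNorm (fun i' : Fin n => A i' j) : ℚ≥0))⁻¹)
      ≤ (k : ℚ≥0) := by
  have h1 : ∀ i : Fin n, (Finset.univ.filter (fun j : Fin k => A i j ≠ 0)).sup
          (fun j => ((hammingNorm (fun i' : Fin n => A i' j) : ℚ≥0))⁻¹) ≤
      ∑ j : Fin k, if A i j ≠ 0 then
        ((hammingNorm (fun i' : Fin n => A i' j) : ℚ≥0))⁻¹ else 0 := by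
    intro i
    rw [← Finset.sum_filter]
    apply Finset.sup_le
    intro j hj
    exact Finset.single_le_sum
      (f := fun j => ((hammingNorm (fun i' : Fin n => A i' j) : ℚ≥0))⁻¹)
      (fun _ _ => zero_le) hj
  refine (Finset.sum_le_sum fun i _ => h1 i).trans ?_
  rw [Finset.sum_comm]
  have h2 : ∀ j : Fin k, (∑ i : Fin n, if A i j ≠ 0 then
        ((hammingNorm (fun i' : Fin n => A i' j) : ℚ≥0))⁻¹ else 0) ≤ 1 := by
    intro j
    rw [← Finset.sum_filter, Finset.sum_const, nsmul_eq_mul]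
    exact mul_inv_le_one
  refine (Finset.sum_le_sum fun j _ => h2 j).trans ?_
  simp
end

section
/- Let F be a finite field and let 𝒞 ⊆ F^n be a linear code of dimension k. For each coordinate i ∈ {1,…,n}, define M_i = max{1/wt(c) : c ∈ 𝒞, c_i ≠ 0} (as a nonnegative rational number), with M_i = 0 if no codeword of 𝒞 is nonzero in coordinate i; equivalently, M_i = 1/min{wt(c) : c ∈ 𝒞, c_i ≠ 0} when such a codeword exists. Then Σ_{i=1}^n M_i ≤ k. -/
open Classical in
theorem code_aux
    (F : Type) [Field F] [Fintype F] [DecidableEq F] (n : ℕ)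
    (C : Submodule F (Fin n → F)) (M : Fin n → ℚ≥0)
    (T : Finset (Fin n → F)) (hT : ∀ c ∈ T, c ∈ C)
    (hM : ∀ i, M i = (T.filter (fun c => c i ≠ 0)).sup
          (fun c => ((hammingNorm c : ℚ≥0))⁻¹)) (m : ℕ) :
    ∀ D : Submodule F (Fin n → F), D ≤ C → Module.finrank F C ≤ Module.finrank F D + m →
    ∑ i ∈ Finset.univ.filter (fun i : Fin n => ∀ d ∈ D, d i = 0), M i ≤ (m : ℚ≥0) := by
  have hzero : ∀ i, (∀ c ∈ C, c i = 0) → M i = 0 := by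
    intro i hi
    rw [hM, Finset.filter_false_of_mem]
    · simp
    · intro c hc
      simpa using hi c (hT c hc)
  induction m with
  | zero =>
    intro D hD hr
    have : D = C := Submodule.eq_of_le_of_finrank_le hD (by simpa using hr)
    subst this
    rw [Finset.sum_eq_zero]
    · simp
    · intro i hi
      exact hzero i (Finset.mem_filter.1 hi).2
  | succ m ih =>
    intro D hD hr
    by_cases hex : ∃ c : C, ∃ i, (∀ d ∈ D, d i = 0) ∧ (c : Fin n → F) i ≠ 0
    · let S : Finset C := Finset.univ.filter
        (fun c => ∃ i, (∀ d ∈ D, d i = 0) ∧ (c : Fin n → F) i ≠ 0)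
      have hS : S.Nonempty := by
        obtain ⟨c, hc⟩ := hex
        exact ⟨c, Finset.mem_filter.2 ⟨Finset.mem_univ _, hc⟩⟩
      obtain ⟨c, hcS, hmin⟩ := S.exists_min_image
        (fun c => hammingNorm (c : Fin n → F)) hS
      obtain ⟨j, hjD, hjc⟩ := (Finset.mem_filter.1 hcS).2
      have hcne : (c : Fin n → F) ≠ 0 := fun h => hjc (by rw [h]; rfl)
      have hpos : 0 < hammingNorm (c : Fin n → F) := hammingNorm_pos_iff.2 hcne
      have hlt : D < D ⊔ Submodule.span F {(c : Fin n → F)} := by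
        refine lt_of_le_of_ne le_sup_left fun h => hjc (hjD _ ?_)
        rw [h]
        exact Submodule.mem_sup_right (Submodule.mem_span_singleton_self _)
      have hle : D ⊔ Submodule.span F {(c : Fin n → F)} ≤ C :=
        sup_le hD (by simp)
      have hfr := Submodule.finrank_lt_finrank_of_lt hlt
      have key := ih _ hle (by omega)
      have hMle : ∀ i, (∀ d ∈ D, d i = 0) →
          M i ≤ ((hammingNorm (c : Fin n → F) : ℚ≥0))⁻¹ := by
        intro i hi
        rw [hM]
        refine Finset.sup_le fun b hb => ?_
        have hb' := (Finset.mem_filter.1 hb).2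
        have := hmin ⟨b, hT b (Finset.mem_filter.1 hb).1⟩ (Finset.mem_filter.2 ⟨Finset.mem_univ _, i, hi, hb'⟩)
        have hc0 : (0 : ℚ≥0) < (hammingNorm (c : Fin n → F) : ℚ≥0) := by exact_mod_cast hpos
        exact inv_anti₀ hc0 (by exact_mod_cast this)
      have hsub : Finset.univ.filter (fun i : Fin n => ∀ d ∈ D, d i = 0) ⊆
          Finset.univ.filter
            (fun i : Fin n => ∀ d ∈ D ⊔ Submodule.span F {(c : Fin n → F)}, d i = 0) ∪
          Finset.univ.filter
            (fun i : Fin n => (∀ d ∈ D, d i = 0) ∧ (c : Fin n → F) i ≠ 0) := by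
        intro i hi
        have hi := (Finset.mem_filter.1 hi).2
        rw [Finset.mem_union, Finset.mem_filter, Finset.mem_filter]
        by_cases h : (c : Fin n → F) i = 0
        · left
          refine ⟨Finset.mem_univ _, fun d hd => ?_⟩
          obtain ⟨y, hy, z, hz, rfl⟩ := Submodule.mem_sup.1 hd
          obtain ⟨a, rfl⟩ := Submodule.mem_span_singleton.1 hz
          simp [hi y hy, h]
        · exact Or.inr ⟨Finset.mem_univ _, hi, h⟩
      have hnew : ∑ i ∈ Finset.univ.filter
            (fun i : Fin n => (∀ d ∈ D, d i = 0) ∧ (c : Fin n → F) i ≠ 0), M i ≤ 1 := by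
        have hcard : (Finset.univ.filter
            (fun i : Fin n => (∀ d ∈ D, d i = 0) ∧ (c : Fin n → F) i ≠ 0)).card ≤
            hammingNorm (c : Fin n → F) := by
          unfold hammingNorm
          refine Finset.card_le_card fun i hi => ?_
          simp only [Finset.mem_filter] at hi ⊢
          exact ⟨hi.1, hi.2.2⟩
        refine (Finset.sum_le_card_nsmul _ _ _
          fun i hi => hMle i (Finset.mem_filter.1 hi).2.1).trans ?_
        have hc0 : (hammingNorm (c : Fin n → F) : ℚ≥0) ≠ 0 := by exact_mod_cast hpos.ne'
        rw [nsmul_eq_mul, ← mul_inv_cancel₀ hc0]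
        gcongr
      refine (Finset.sum_le_sum_of_subset hsub).trans ?_
      refine le_trans (le_of_le_of_eq (le_add_of_nonneg_right zero_le)
        (Finset.sum_union_inter)) ?_
      push_cast
      exact add_le_add key hnew
    · push Not at hex
      rw [Finset.sum_eq_zero]
      · simp
      · intro i hi
        exact hzero i fun c hc => hex ⟨c, hc⟩ i (Finset.mem_filter.1 hi).2



open Classical in
/-- For a linear code `𝒞 ⊆ F^n` of dimension `k`, summing over coordinates
`i` the maximum of `1/wt(c)` over codewords `c ∈ 𝒞` nonzero at `i` (taking `0` if no
codeword is nonzero at `i`) gives at most `k`. -/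
theorem code_reciprocal_weight_sum
    (F : Type) [Field F] [Fintype F] [DecidableEq F] (n k : ℕ)
    (𝒞 : Submodule F (Fin n → F)) (hdim : Module.finrank F 𝒞 = k) :
    ∑ i : Fin n,
        ((Finset.univ : Finset 𝒞).filter (fun c => (c : Fin n → F) i ≠ 0)).sup
          (fun c => ((hammingNorm (c : Fin n → F) : ℚ≥0))⁻¹)
      ≤ (k : ℚ≥0) := by

  have h := fun hT => code_aux F n 𝒞 _ (do let a ← (Finset.univ : Finset 𝒞); pure (a : Fin n → F)) hT (fun _ => rfl) k ⊥ bot_le (by simp [hdim])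
  rw [Finset.filter_true_of_mem] at h
  · refine h fun c hc => ?_
    simp only [Finset.bind_def, Finset.pure_def, Finset.mem_sup, Finset.mem_singleton] at hc
    obtain ⟨a, _, rfl⟩ := hc
    exact a.2
  · intro i _ d hd
    rw [(Submodule.mem_bot F).1 hd]
    rfl
end

section
/- There is an absolute constant C > 0 with the following property. Let k ≥ 2, let ε ∈ (0,1), and let Γ = {r_1,…,r_n} ⊆ F_2^k be a set of generators with positive real weights w_1,…,w_n, defining the weighted Cayley graph G over F_2^k with Laplacian L_G given by L_G(u,v) = (Σ_{i=1}^n w_i)·[u = v] − Σ_{i : r_i = u + v} w_i. Then there exists a subset T ⊆ {1,…,n} with |T| ≤ C · k · (log(k/ε))^C / ε², together with nonnegative weights (ŵ_i)_{i∈T}, such that the Laplacian L_Ĝ of the weighted Cayley graph Ĝ generated by {r_i : i ∈ T} with weights (ŵ_i) satisfies (1−ε)·L_G ⪯ L_Ĝ ⪯ (1+ε)·L_G; that is, both matrices L_Ĝ − (1−ε)·L_G and (1+ε)·L_G − L_Ĝ are positive semidefinite. -/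
/-- The Laplacian of the weighted Cayley graph over `F₂^k` with generators `r i`
and weights `w i`. -/
noncomputable def cayleyLaplacian (k n : ℕ) (r : Fin n → (Fin k → ZMod 2))
    (w : Fin n → ℝ) : Matrix (Fin k → ZMod 2) (Fin k → ZMod 2) ℝ :=
  Matrix.of fun u v =>
    (∑ i, w i) * (if u = v then (1 : ℝ) else 0)
      - ∑ i ∈ Finset.univ.filter (fun i => r i = u + v), w i

section Helpers

open Finset

lemma layer_cake {ι : Type*} [DecidableEq ι] (a : ι → ℝ) :
    ∀ (I : Finset ι) (κ : ι → ℝ), (∀ i ∈ I, 0 ≤ κ i) →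
      (∀ j ∈ I, 0 ≤ ∑ i ∈ I.filter (fun i => κ j ≤ κ i), a i) →
      0 ≤ ∑ i ∈ I, κ i * a i := by
  intro I
  induction I using Finset.strongInduction with
  | H I ih =>
    intro κ hκ h
    rcases I.eq_empty_or_nonempty with rfl | hne
    · simp
    obtain ⟨j, hj, hmin⟩ := I.exists_min_image κ hne
    have h1 : 0 ≤ ∑ i ∈ I, a i := by
      have := h j hj
      rwa [Finset.filter_true_of_mem (fun i hi => hmin i hi)] at this
    have h2 : 0 ≤ ∑ i ∈ I.filter (fun i => κ j < κ i), (κ i - κ j) * a i := by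
      apply ih (I.filter (fun i => κ j < κ i))
        (Finset.filter_ssubset.2 ⟨j, hj, lt_irrefl _⟩) (fun i => κ i - κ j)
      · intro i hi
        exact sub_nonneg.2 (Finset.mem_filter.1 hi).2.le
      · intro l hl
        have hl' := Finset.mem_filter.1 hl
        have := h l hl'.1
        convert this using 2
        ext i
        simp only [Finset.mem_filter]
        constructor
        · rintro ⟨⟨h1, h2⟩, h3⟩
          exact ⟨h1, by linarith⟩
        · rintro ⟨h1, h2⟩
          exact ⟨⟨h1, by linarith [hl'.2]⟩, by linarith⟩
    have h3 : ∑ i ∈ I.filter (fun i => κ j < κ i), (κ i - κ j) * a i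
        = ∑ i ∈ I, (κ i - κ j) * a i := by
      apply Finset.sum_subset (Finset.filter_subset _ _)
      intro i hi hni
      have : κ i = κ j := by
        apply le_antisymm _ (hmin i hi)
        by_contra hlt
        exact hni (Finset.mem_filter.2 ⟨hi, not_le.1 hlt⟩)
      simp [this]
    have h4 : ∑ i ∈ I, κ i * a i = ∑ i ∈ I, (κ i - κ j) * a i + κ j * ∑ i ∈ I, a i := by
      rw [Finset.mul_sum, ← Finset.sum_add_distrib]
      exact Finset.sum_congr rfl (fun i _ => by ring)
    rw [h4, ← h3]
    have := mul_nonneg (hκ j hj) h1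
    linarith

lemma chern_up {ε : ℝ} (h0 : 0 < ε) (h1 : ε < 1) :
    ε - (1 + ε) * Real.log (1 + ε) ≤ - ε ^ 2 / 3 := by
  have h := Real.le_log_one_add_of_nonneg h0.le
  have h2 : (1 + ε) * (2 * ε / (ε + 2)) ≤ (1 + ε) * Real.log (1 + ε) := by gcongr
  have h3 : ε + ε ^ 2 / 3 ≤ (1 + ε) * (2 * ε / (ε + 2)) := by
    rw [← mul_div_assoc, le_div_iff₀ (by linarith)]
    nlinarith [mul_pos h0 h0, mul_pos (mul_pos h0 h0) (sub_pos.2 h1)]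
  linarith

lemma chern_lo {ε : ℝ} (h0 : 0 < ε) :
    Real.exp (-ε) - 1 + (1 - ε) * ε ≤ - ε ^ 2 / 3 := by
  have h := Real.quadratic_le_exp_of_nonneg h0.le
  have h2 : Real.exp (-ε) ≤ 1 - ε + ε ^ 2 / 2 := by
    rw [Real.exp_neg, inv_le_comm₀ (Real.exp_pos _) (by nlinarith [sq_nonneg (ε - 1)])]
    refine le_trans ?_ h
    rw [inv_le_iff_one_le_mul₀ (by nlinarith [sq_nonneg (ε - 1)])]
    nlinarith [sq_nonneg (ε ^ 2)]
  nlinarith [sq_nonneg ε]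

lemma mgf_bound_s8 {ι : Type*} [Fintype ι] [DecidableEq ι] (π : ι → ℝ) (h1 : ∀ i, 0 ≤ π i)
    (hs : ∑ i, π i = 1) (N : ℕ) (c : Finset ι) (z : ℝ) (hz : 0 ≤ z) :
    ∑ ω : Fin N → ι, (∏ j, π (ω j)) * z ^ (univ.filter (fun j => ω j ∈ c)).card
      ≤ Real.exp (N * (∑ i ∈ c, π i) * (z - 1)) := by
  have e1 : ∀ ω : Fin N → ι, (∏ j, π (ω j)) * z ^ (univ.filter (fun j => ω j ∈ c)).card
      = ∏ j, (π (ω j) * (if ω j ∈ c then z else 1)) := by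
    intro ω
    rw [Finset.prod_mul_distrib, Finset.prod_ite]
    simp
  rw [Finset.sum_congr rfl (fun ω _ => e1 ω),
    ← Fintype.sum_pow (fun i => π i * (if i ∈ c then z else 1)) N]
  have e2 : ∑ i, π i * (if i ∈ c then z else 1) = (∑ i ∈ c, π i) * (z - 1) + 1 := by
    have : ∀ i, π i * (if i ∈ c then z else 1) = (if i ∈ c then π i else 0) * (z - 1) + π i := by
      intro i; split_ifs <;> ring
    rw [Finset.sum_congr rfl (fun i _ => this i), Finset.sum_add_distrib, hs, ← Finset.sum_mul]
    simp
  rw [e2, mul_assoc, Real.exp_nat_mul]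
  refine pow_le_pow_left₀ ?_ (Real.add_one_le_exp _) _
  rw [← e2]
  exact Finset.sum_nonneg (fun i _ => mul_nonneg (h1 i) (by split_ifs <;> linarith))

lemma sample_exists {ι τ : Type*} [Fintype ι] [DecidableEq ι] (π : ι → ℝ) (h1 : ∀ i, 0 ≤ π i)
    (hs : ∑ i, π i = 1) (N : ℕ) (J : Finset τ) (c : τ → Finset ι) {ε : ℝ} (h0 : 0 < ε)
    (hε : ε < 1)
    (hsum : ∑ p ∈ J, 2 * Real.exp (-(N * (∑ i ∈ c p, π i)) * (ε ^ 2 / 3)) < 1) :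
    ∃ ω : Fin N → ι, ∀ p ∈ J,
      (1 - ε) * (N * ∑ i ∈ c p, π i) ≤ ((univ.filter (fun j => ω j ∈ c p)).card : ℝ) ∧
      ((univ.filter (fun j => ω j ∈ c p)).card : ℝ) ≤ (1 + ε) * (N * ∑ i ∈ c p, π i) := by
  classical
  set m : τ → ℝ := fun p => N * ∑ i ∈ c p, π i with hm
  set H : τ → (Fin N → ι) → ℕ := fun p ω => (univ.filter (fun j => ω j ∈ c p)).card with hH
  have hm0 : ∀ p, 0 ≤ m p := fun p =>
    mul_nonneg (Nat.cast_nonneg _) (Finset.sum_nonneg (fun i _ => h1 i))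
  set P : (Fin N → ι) → ℝ := fun ω => ∏ j, π (ω j) with hP
  have hP0 : ∀ ω, 0 ≤ P ω := fun ω => Finset.prod_nonneg (fun j _ => h1 _)
  have hP1 : ∑ ω, P ω = 1 := by
    rw [hP, ← Fintype.sum_pow π N, hs, one_pow]
  set U : τ → (Fin N → ι) → ℝ := fun p ω =>
    (1 + ε) ^ H p ω * Real.exp (-((1 + ε) * m p * Real.log (1 + ε))) with hU
  set D : τ → (Fin N → ι) → ℝ := fun p ω =>
    Real.exp (-ε) ^ H p ω * Real.exp ((1 - ε) * m p * ε) with hD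
  have hU0 : ∀ p ω, 0 ≤ U p ω := fun p ω => by positivity
  have hD0 : ∀ p ω, 0 ≤ D p ω := fun p ω => by positivity
  have EU : ∀ p, ∑ ω, P ω * U p ω ≤ Real.exp (- m p * (ε ^ 2 / 3)) := by
    intro p
    have := mgf_bound_s8 π h1 hs N (c p) (1 + ε) (by linarith)
    calc ∑ ω, P ω * U p ω = (∑ ω, P ω * (1 + ε) ^ H p ω)
          * Real.exp (-((1 + ε) * m p * Real.log (1 + ε))) := by
          rw [Finset.sum_mul]; exact Finset.sum_congr rfl (fun ω _ => by simp only [hU]; ring)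
      _ ≤ Real.exp (m p * (1 + ε - 1)) * Real.exp (-((1 + ε) * m p * Real.log (1 + ε))) := by
          gcongr
      _ ≤ _ := by
          rw [← Real.exp_add]
          apply Real.exp_le_exp.2
          have := mul_le_mul_of_nonneg_left (chern_up h0 hε) (hm0 p)
          linarith
  have ED : ∀ p, ∑ ω, P ω * D p ω ≤ Real.exp (- m p * (ε ^ 2 / 3)) := by
    intro p
    have := mgf_bound_s8 π h1 hs N (c p) (Real.exp (-ε)) (Real.exp_pos _).le
    calc ∑ ω, P ω * D p ω = (∑ ω, P ω * Real.exp (-ε) ^ H p ω)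
          * Real.exp ((1 - ε) * m p * ε) := by
          rw [Finset.sum_mul]; exact Finset.sum_congr rfl (fun ω _ => by simp only [hD]; ring)
      _ ≤ Real.exp (m p * (Real.exp (-ε) - 1)) * Real.exp ((1 - ε) * m p * ε) := by
          gcongr
      _ ≤ _ := by
          rw [← Real.exp_add]
          apply Real.exp_le_exp.2
          have := mul_le_mul_of_nonneg_left (chern_lo h0) (hm0 p)
          linarith
  have hex : ∃ ω, ∑ p ∈ J, (U p ω + D p ω) < 1 := by
    by_contra hcon
    push Not at hcon
    have : (1 : ℝ) ≤ ∑ ω, P ω * ∑ p ∈ J, (U p ω + D p ω) := by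
      rw [← hP1]
      exact Finset.sum_le_sum (fun ω _ => le_mul_of_one_le_right (hP0 ω) (hcon ω))
    have h2 : ∑ ω, P ω * ∑ p ∈ J, (U p ω + D p ω)
        = ∑ p ∈ J, (∑ ω, P ω * U p ω + ∑ ω, P ω * D p ω) := by
      simp_rw [Finset.mul_sum, mul_add]
      rw [Finset.sum_comm]
      simp_rw [Finset.sum_add_distrib]
    have h3 : ∑ p ∈ J, (∑ ω, P ω * U p ω + ∑ ω, P ω * D p ω)
        ≤ ∑ p ∈ J, 2 * Real.exp (-m p * (ε ^ 2 / 3)) :=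
      Finset.sum_le_sum (fun p _ => by linarith [EU p, ED p])
    linarith
  obtain ⟨ω, hω⟩ := hex
  refine ⟨ω, fun p hp => ?_⟩
  have hlt : U p ω + D p ω < 1 := lt_of_le_of_lt
    (Finset.single_le_sum (f := fun p => U p ω + D p ω)
      (fun p _ => add_nonneg (hU0 p ω) (hD0 p ω)) hp) hω
  have hlog : 0 < Real.log (1 + ε) := Real.log_pos (by linarith)
  constructor
  · have hd : D p ω < 1 := by linarith [hU0 p ω]
    simp only [hD] at hd
    rw [← Real.exp_nat_mul, ← Real.exp_add, Real.exp_lt_one_iff] at hd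
    have : ((1 - ε) * m p - H p ω) * ε < 0 := by linarith
    have := (neg_of_mul_neg_left this h0.le)
    linarith
  · have hd : U p ω < 1 := by linarith [hD0 p ω]
    simp only [hU] at hd
    have e : (1 + ε) ^ H p ω = Real.exp (H p ω * Real.log (1 + ε)) := by
      rw [Real.exp_nat_mul, Real.exp_log (by linarith)]
    rw [e, ← Real.exp_add, Real.exp_lt_one_iff] at hd
    have : (H p ω - (1 + ε) * m p) * Real.log (1 + ε) < 0 := by linarith
    have := (neg_of_mul_neg_left this hlog.le)
    linarith

lemma kkt {α ι : Type*} [Fintype α] [Nonempty α] [Fintype ι] (A : α → ι → ℝ)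
    (hA : ∀ a i, 0 ≤ A a i) (hAi : ∀ i, ∃ a, 0 < A a i) (w : ι → ℝ) (hw : ∀ i, 0 < w i) :
    ∃ μ : α → ℝ, (∀ a, 0 ≤ μ a) ∧ ∑ a, μ a = 1 ∧ (∀ i, 0 < ∑ a, μ a * A a i) ∧
      ∀ a, ∑ i, A a i * (w i / ∑ b, μ b * A b i) ≤ ∑ i, w i := by
  classical
  set u : (α → ℝ) → ι → ℝ := fun μ i => ∑ a, μ a * A a i with hu
  have hcont : Continuous (fun μ : α → ℝ => ∏ i, (u μ i) ^ (w i)) := by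
    apply continuous_finsetProd
    intro i _
    apply Continuous.rpow_const
    · simp only [hu]; fun_prop
    · intro x; exact Or.inr (hw i).le
  have hne : (stdSimplex ℝ α).Nonempty := ⟨_, single_mem_stdSimplex ℝ (Classical.arbitrary α)⟩
  obtain ⟨μ, hμ, hmax⟩ := (isCompact_stdSimplex ℝ α).exists_isMaxOn hne hcont.continuousOn
  have hu0 : ∀ i, 0 ≤ u μ i := fun i =>
    Finset.sum_nonneg (fun a _ => mul_nonneg (hμ.1 a) (hA a i))
  have hpos : ∀ i, 0 < u μ i := by
    by_contra hcon
    push Not at hcon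
    obtain ⟨i, hi⟩ := hcon
    have hi0 : u μ i = 0 := le_antisymm hi (hu0 i)
    have hc : (0 : ℝ) < Fintype.card α := by exact_mod_cast Fintype.card_pos
    have hunif : (fun _ : α => (Fintype.card α : ℝ)⁻¹) ∈ stdSimplex ℝ α := by
      refine ⟨fun a => by positivity, ?_⟩
      simp [hc.ne']
    have h1 := hmax hunif
    simp only [Set.mem_ofPred_eq] at h1
    have h2 : ∏ i, (u μ i) ^ (w i) = 0 := by
      apply Finset.prod_eq_zero (Finset.mem_univ i)
      rw [hi0, Real.zero_rpow (hw i).ne']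
    rw [h2] at h1
    have h3 : 0 < ∏ i, (u (fun _ : α => (Fintype.card α : ℝ)⁻¹) i) ^ (w i) := by
      apply Finset.prod_pos
      intro j _
      apply Real.rpow_pos_of_pos
      obtain ⟨a, ha⟩ := hAi j
      exact Finset.sum_pos' (fun b _ => mul_nonneg (by positivity) (hA b j))
        ⟨a, Finset.mem_univ _, mul_pos (by positivity) ha⟩
    linarith
  refine ⟨μ, hμ.1, hμ.2, hpos, fun a => ?_⟩
  change ∑ i, A a i * (w i / u μ i) ≤ ∑ i, w i
  set x : ι → ℝ := fun i => (A a i - u μ i) / u μ i with hx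
  have hx1 : ∀ i, -1 ≤ x i := by
    intro i
    rw [hx, le_div_iff₀ (hpos i)]
    linarith [hA a i]
  have hut : ∀ t : ℝ, ∀ i, u ((1 - t) • μ + t • (Pi.single a (1 : ℝ))) i
      = u μ i * (1 + t * x i) := by
    intro t i
    have : u μ i * (1 + t * x i) = (1 - t) * u μ i + t * A a i := by
      simp only [hx]; field_simp [(hpos i).ne']; ring
    rw [this]
    simp only [hu, Pi.add_apply, Pi.smul_apply, smul_eq_mul, add_mul, Finset.sum_add_distrib,
      mul_assoc, ← Finset.mul_sum]
    congr 2
    rw [Finset.sum_eq_single a]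
    · simp
    · intro b _ hb; simp [hb]
    · simp
  have key : ∀ t : ℝ, 0 < t → t < 1 → ∑ i, w i * (x i / (1 + t * x i)) ≤ 0 := by
    intro t ht0 ht1
    have hp : ∀ i, 0 < 1 + t * x i := by
      intro i; nlinarith [hx1 i]
    have hmem : (1 - t) • μ + t • (Pi.single a (1 : ℝ)) ∈ stdSimplex ℝ α :=
      convex_stdSimplex ℝ α hμ (single_mem_stdSimplex ℝ a) (by linarith) ht0.le (by ring)
    have h1 := hmax hmem
    simp only [Set.mem_ofPred_eq, hut] at h1
    have h2 : ∏ i, (u μ i * (1 + t * x i)) ^ w i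
        = (∏ i, u μ i ^ w i) * ∏ i, (1 + t * x i) ^ w i := by
      rw [← Finset.prod_mul_distrib]
      exact Finset.prod_congr rfl (fun i _ => Real.mul_rpow (hu0 i) (hp i).le)
    rw [h2] at h1
    have h3 : 0 < ∏ i, u μ i ^ w i :=
      Finset.prod_pos (fun i _ => Real.rpow_pos_of_pos (hpos i) _)
    have h4 : ∏ i, (1 + t * x i) ^ w i ≤ 1 := by
      by_contra hcon
      push Not at hcon
      nlinarith
    have h5 : ∑ i, w i * Real.log (1 + t * x i) ≤ 0 := by
      have := Real.log_nonpos (Finset.prod_nonneg (fun i _ => (Real.rpow_nonneg (hp i).le _))) h4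
      rw [Real.log_prod (fun i _ => (Real.rpow_pos_of_pos (hp i) _).ne')] at this
      convert this using 2 with i
      rw [Real.log_rpow (hp i)]
    have h6 : t * ∑ i, w i * (x i / (1 + t * x i)) ≤ ∑ i, w i * Real.log (1 + t * x i) := by
      rw [Finset.mul_sum]
      apply Finset.sum_le_sum
      intro i _
      have := Real.one_sub_inv_le_log_of_pos (hp i)
      have e : t * (w i * (x i / (1 + t * x i))) = w i * (1 - (1 + t * x i)⁻¹) := by
        field_simp [(hp i).ne']; ring
      rw [e]
      exact mul_le_mul_of_nonneg_left this (hw i).le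
    by_contra hcon
    push Not at hcon
    nlinarith
  have hlim : Filter.Tendsto (fun t : ℝ => ∑ i, w i * (x i / (1 + t * x i)))
      (nhdsWithin 0 (Set.Ioi 0)) (nhds (∑ i, w i * (x i / (1 + 0 * x i)))) := by
    apply Filter.Tendsto.mono_left _ nhdsWithin_le_nhds
    apply tendsto_finsetSum
    intro i _
    apply Filter.Tendsto.const_mul
    have : ContinuousAt (fun t : ℝ => x i / (1 + t * x i)) 0 := by
      apply ContinuousAt.div (by fun_prop) (by fun_prop) (by simp)
    exact this
  have hle : ∑ i, w i * (x i / (1 + 0 * x i)) ≤ 0 := by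
    apply le_of_tendsto hlim
    filter_upwards [Ioo_mem_nhdsGT (show (0 : ℝ) < 1 by norm_num)] with t ht
    exact key t ht.1 ht.2
  have e : ∑ i, w i * (x i / (1 + 0 * x i)) = ∑ i, A a i * (w i / u μ i) - ∑ i, w i := by
    rw [← Finset.sum_sub_distrib]
    apply Finset.sum_congr rfl
    intro i _
    have := (hpos i).ne'
    rw [zero_mul, add_zero, div_one]
    simp only [hx]; field_simp
  linarith

def IsBas (K : Type*) {V ι : Type*} [Field K] [AddCommGroup V] [Module K V] (r : ι → V)
    (B : Finset ι) : Prop :=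
  LinearIndepOn K r (B : Set ι) ∧ ∀ i, r i ∈ Submodule.span K (r '' (B : Set ι))

section
set_option linter.unusedSectionVars false
variable {K V ι : Type*} [Field K] [AddCommGroup V] [Module K V] [Fintype ι] [DecidableEq ι]
  {r : ι → V}

lemma IsBas.card_eq {B : Finset ι} (h : IsBas K r B) :
    B.card = Module.finrank K (Submodule.span K (Set.range r)) := by
  have h1 := finrank_span_eq_card (R := K) (b := fun i : (B : Set ι) => r i) h.1
  have h2 : Submodule.span K (Set.range (fun i : (B : Set ι) => r i))
      = Submodule.span K (Set.range r) := by
    apply le_antisymm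
    · apply Submodule.span_mono
      rintro _ ⟨i, rfl⟩
      exact ⟨i, rfl⟩
    · rw [Submodule.span_le]
      rintro _ ⟨i, rfl⟩
      have := h.2 i
      rwa [Set.image_eq_range] at this
  rw [h2] at h1
  rw [h1]
  simp

lemma exists_bas_ext (A C : Finset ι) (hAC : A ⊆ C) (hA : LinearIndepOn K r (A : Set ι))
    (hC : ∀ i, r i ∈ Submodule.span K (r '' (C : Set ι))) :
    ∃ B, A ⊆ B ∧ B ⊆ C ∧ IsBas K r B := by
  obtain ⟨b, hb1, hb2, hb3, hb4⟩ := exists_linearIndepOn_extension hA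
    (show (A : Set ι) ⊆ (C : Set ι) by exact_mod_cast hAC)
  have hfin : b.Finite := Set.toFinite b
  refine ⟨hfin.toFinset, ?_, ?_, ?_, ?_⟩
  · intro i hi; simpa using hb2 (by exact_mod_cast hi)
  · intro i hi; have := hb1 (by simpa using hi); exact_mod_cast this
  · simpa using hb4
  · intro i
    rw [hfin.coe_toFinset]
    exact (Submodule.span_le.2 hb3) (hC i)

lemma exists_bas_mem (i : ι) (hi : r i ≠ 0) : ∃ B, i ∈ B ∧ IsBas K r B := by
  obtain ⟨B, h1, -, h3⟩ := exists_bas_ext (K := K) (r := r) {i} univ (Finset.subset_univ _)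
    (by simpa using LinearIndepOn.singleton (R := K) hi)
    (fun j => Submodule.subset_span ⟨j, by simp, rfl⟩)
  exact ⟨B, h1 (by simp), h3⟩

/-- A maximum-weight base contains, for each `i`, enough heavy elements to span `r i`. -/
lemma greedy {B : Finset ι} (hB : IsBas K r B) (κ : ι → ℝ)
    (hmax : ∀ B', IsBas K r B' → ∑ i ∈ B', κ i ≤ ∑ i ∈ B, κ i) (i : ι) :
    r i ∈ Submodule.span K (r '' ((B.filter (fun b => κ i ≤ κ b) : Finset ι) : Set ι)) := by
  by_contra hcon
  set A := B.filter (fun b => κ i ≤ κ b) with hA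
  have hAB : A ⊆ B := Finset.filter_subset _ _
  have hiA : i ∉ A := fun h => hcon (Submodule.subset_span ⟨i, h, rfl⟩)
  have hiB : i ∉ B := fun h => hiA (Finset.mem_filter.2 ⟨h, le_rfl⟩)
  have hind : LinearIndepOn K r ((insert i A : Finset ι) : Set ι) := by
    rw [Finset.coe_insert]
    exact LinearIndepOn.insert (hB.1.mono (by exact_mod_cast hAB)) hcon
  obtain ⟨B', h1, h2, h3⟩ := exists_bas_ext (insert i A) (insert i B)
    (Finset.insert_subset_insert _ hAB) hind
    (fun j => Submodule.span_mono (Set.image_mono (by simp)) (hB.2 j))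
  have hcard : B'.card = B.card := h3.card_eq.trans hB.card_eq.symm
  have hiB' : i ∈ B' := h1 (Finset.mem_insert_self _ _)
  have hsub : B'.erase i ⊆ B := by
    intro j hj
    have := h2 (Finset.mem_of_mem_erase hj)
    exact (Finset.mem_insert.1 this).resolve_left (Finset.ne_of_mem_erase hj)
  have hc1 : (B'.erase i).card + 1 = B.card := by
    rw [Finset.card_erase_add_one hiB', hcard]
  have hsd : (B \ B'.erase i).card = 1 := by
    rw [Finset.card_sdiff_of_subset hsub]; omega
  obtain ⟨b, hb⟩ := Finset.card_eq_one.1 hsd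
  have hbm : b ∈ B \ B'.erase i := by rw [hb]; simp
  rw [Finset.mem_sdiff] at hbm
  have hbA : b ∉ A := by
    intro h
    apply hbm.2
    refine Finset.mem_erase.2 ⟨?_, h1 (Finset.mem_insert_of_mem h)⟩
    rintro rfl; exact hiA h
  have hlt : κ b < κ i := by
    by_contra h
    exact hbA (Finset.mem_filter.2 ⟨hbm.1, not_lt.1 h⟩)
  have e1 : ∑ j ∈ B, κ j = ∑ j ∈ B'.erase i, κ j + κ b := by
    rw [← Finset.sum_sdiff hsub, hb, Finset.sum_singleton]; ring
  have e2 : ∑ j ∈ B', κ j = ∑ j ∈ B'.erase i, κ j + κ i :=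
    (Finset.sum_erase_add _ _ hiB').symm
  have := hmax B' h3
  linarith

/-- All weights occurring in one maximum-weight base occur in any other. -/
lemma level_mem {B0 B1 : Finset ι} (κ : ι → ℝ)
    (h0 : ∀ i, r i ∈ Submodule.span K (r '' ((B0.filter (fun b => κ i ≤ κ b) : Finset ι) : Set ι)))
    (h1 : ∀ i, r i ∈ Submodule.span K (r '' ((B1.filter (fun b => κ i ≤ κ b) : Finset ι) : Set ι)))
    (hB1 : IsBas K r B1) (i : ι) (hi : i ∈ B1) : ∃ b ∈ B0, κ b = κ i := by
  by_contra hcon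
  push Not at hcon
  have hnot := linearIndepOn_iff_notMem_span.1 hB1.1 i (by exact_mod_cast hi)
  apply hnot
  refine (Submodule.span_le.2 ?_) (h0 i)
  rintro _ ⟨b, hb, rfl⟩
  have hb' := Finset.mem_filter.1 (Finset.mem_coe.1 hb)
  have hlt : κ i < κ b := lt_of_le_of_ne hb'.2 (fun h => hcon b hb'.1 h.symm)
  refine Submodule.span_mono (Set.image_mono ?_) (h1 b)
  intro j hj
  have hj' := Finset.mem_filter.1 (Finset.mem_coe.1 hj)
  refine ⟨by exact_mod_cast hj'.1, ?_⟩
  rintro rfl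
  linarith [hj'.2]

end

/-- Fractional base packing optimum. -/
lemma exists_packing (K : Type*) {V ι : Type*} [Field K] [AddCommGroup V] [Module K V] [Fintype ι]
    [DecidableEq ι] (r : ι → V) (hr : ∀ i, r i ≠ 0) (w : ι → ℝ) (hw : ∀ i, 0 < w i)
    [Fintype {B : Finset ι // IsBas K r B}] :
    ∃ μ : {B : Finset ι // IsBas K r B} → ℝ, (∀ B, 0 ≤ μ B) ∧ ∑ B, μ B = 1 ∧
      ∃ u : ι → ℝ, (∀ i, u i = ∑ B, μ B * (if i ∈ B.1 then 1 else 0)) ∧ (∀ i, 0 < u i) ∧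
        ∀ B, 0 < μ B → ∀ B', IsBas K r B' →
          ∑ i ∈ B', w i / u i ≤ ∑ i ∈ B.1, w i / u i := by
  obtain ⟨B0, -, -, hB0⟩ := exists_bas_ext (K := K) (r := r) ∅ univ (Finset.subset_univ _)
    (by simp) (fun j => Submodule.subset_span ⟨j, by simp, rfl⟩)
  have : Nonempty {B : Finset ι // IsBas K r B} := ⟨⟨B0, hB0⟩⟩
  obtain ⟨μ, h1, h2, h3, h4⟩ := kkt (α := {B : Finset ι // IsBas K r B})
    (fun B i => if i ∈ B.1 then (1 : ℝ) else 0)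
    (fun B i => by split_ifs <;> norm_num)
    (fun i => by
      obtain ⟨B, hiB, hB⟩ := exists_bas_mem (K := K) (r := r) i (hr i)
      exact ⟨⟨B, hB⟩, by simp [hiB]⟩) w hw
  refine ⟨μ, h1, h2, _, fun i => rfl, h3, ?_⟩
  set u : ι → ℝ := fun i => ∑ B, μ B * (if i ∈ B.1 then (1 : ℝ) else 0) with hu
  have h5 : ∀ B : {B : Finset ι // IsBas K r B}, ∑ i ∈ B.1, w i / u i ≤ ∑ i, w i := by
    intro B
    have := h4 B
    simpa [ite_mul, hu] using this
  have h6 : ∑ B, μ B * (∑ i, w i - ∑ i ∈ B.1, w i / u i) = 0 := by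
    simp_rw [mul_sub, Finset.sum_sub_distrib, ← Finset.sum_mul, h2, one_mul]
    rw [sub_eq_zero]
    have : ∀ B : {B : Finset ι // IsBas K r B}, μ B * ∑ i ∈ B.1, w i / u i
        = ∑ i, (μ B * if i ∈ B.1 then (1 : ℝ) else 0) * (w i / u i) := by
      intro B
      rw [Finset.mul_sum, ← Finset.sum_subset (Finset.subset_univ B.1)]
      · exact Finset.sum_congr rfl (fun i hi => by simp [hi])
      · intro i _ hi; simp [hi]
    rw [Finset.sum_congr rfl (fun B _ => this B), Finset.sum_comm]
    apply Finset.sum_congr rfl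
    intro i _
    rw [← Finset.sum_mul]
    exact (mul_div_cancel₀ (w i) (h3 i).ne').symm
  intro B hB B' hB'
  have h7 := (Finset.sum_eq_zero_iff_of_nonneg
    (fun B _ => mul_nonneg (h1 B) (sub_nonneg.2 (h5 B)))).1 h6 B (Finset.mem_univ _)
  have h8 := (mul_eq_zero.1 h7).resolve_left hB.ne'
  linarith [h5 ⟨B', hB'⟩]

lemma dot_span {k : ℕ} {S : Set (Fin k → ZMod 2)} (y : Fin k → ZMod 2)
    (h : ∀ v ∈ S, y ⬝ᵥ v = 0) {v : Fin k → ZMod 2} (hv : v ∈ Submodule.span (ZMod 2) S) :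
    y ⬝ᵥ v = 0 := by
  induction hv using Submodule.span_induction with
  | mem x hx => exact h x hx
  | zero => simp
  | add x z _ _ h1 h2 => rw [dotProduct_add, h1, h2, add_zero]
  | smul a x _ h1 => rw [dotProduct_smul, h1, smul_zero]

lemma zmod2_eq {a b : ZMod 2} (h : a ≠ 0 ↔ b ≠ 0) : a = b := by
  revert a b; decide

lemma count_bound {k : ℕ} {ι : Type*} [Fintype ι] [DecidableEq ι] (r : ι → Fin k → ZMod 2)
    (κ : ι → ℝ) (B : Finset ι)
    (hB : ∀ i, r i ∈ Submodule.span (ZMod 2)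
      (r '' ((B.filter (fun b => κ i ≤ κ b) : Finset ι) : Set ι)))
    (s x : ℝ) (hx : 0 ≤ x) :
    ∑ c ∈ ((univ : Finset (Fin k → ZMod 2)).image
        (fun y => univ.filter (fun i => y ⬝ᵥ r i ≠ 0 ∧ s ≤ κ i))).erase ∅,
      x ^ (c ∩ B).card ≤ (1 + x) ^ B.card - 1 := by
  set C := (univ : Finset (Fin k → ZMod 2)).image
        (fun y => univ.filter (fun i => y ⬝ᵥ r i ≠ 0 ∧ s ≤ κ i)) with hC
  have hinj : ∀ c ∈ C, ∀ c' ∈ C, c ∩ B = c' ∩ B → c = c' := by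
    intro c hc c' hc' h
    obtain ⟨y, -, rfl⟩ := Finset.mem_image.1 hc
    obtain ⟨z, -, rfl⟩ := Finset.mem_image.1 hc'
    have key : ∀ i, s ≤ κ i → y ⬝ᵥ r i = z ⬝ᵥ r i := by
      intro i hi
      have : (y - z) ⬝ᵥ r i = 0 := by
        refine dot_span (y - z) ?_ (hB i)
        rintro _ ⟨b, hb, rfl⟩
        have hb' := Finset.mem_filter.1 (Finset.mem_coe.1 hb)
        rw [sub_dotProduct, sub_eq_zero]
        apply zmod2_eq
        have := Finset.ext_iff.1 h b
        simpa [hb'.1, hi.trans hb'.2] using this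
      rwa [sub_dotProduct, sub_eq_zero] at this
    ext i
    simp only [Finset.mem_filter, Finset.mem_univ, true_and]
    constructor
    · rintro ⟨h1, h2⟩; exact ⟨key i h2 ▸ h1, h2⟩
    · rintro ⟨h1, h2⟩; exact ⟨(key i h2).symm ▸ h1, h2⟩
  have hempty : ∅ ∈ C := Finset.mem_image.2 ⟨0, Finset.mem_univ _, by simp⟩
  have h1 : ∑ c ∈ C.erase ∅, x ^ (c ∩ B).card
      = ∑ t ∈ (C.erase ∅).image (fun c => c ∩ B), x ^ t.card := by
    rw [Finset.sum_image]
    intro c hc c' hc' h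
    exact hinj c (Finset.mem_of_mem_erase hc) c' (Finset.mem_of_mem_erase hc') h
  have h2 : ∑ t ∈ (C.erase ∅).image (fun c => c ∩ B), x ^ t.card
      ≤ ∑ t ∈ B.powerset.erase ∅, x ^ t.card := by
    apply Finset.sum_le_sum_of_subset_of_nonneg
    · intro t ht
      obtain ⟨c, hc, rfl⟩ := Finset.mem_image.1 ht
      refine Finset.mem_erase.2 ⟨?_, Finset.mem_powerset.2 Finset.inter_subset_right⟩
      intro h
      apply Finset.ne_of_mem_erase hc
      exact hinj c (Finset.mem_of_mem_erase hc) ∅ hempty (by simpa using h)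
    · intro t _ _; positivity
  have h3 : ∑ t ∈ B.powerset.erase ∅, x ^ t.card + 1 = (1 + x) ^ B.card := by
    have := Finset.sum_pow_mul_eq_add_pow x 1 B
    simp only [one_pow, mul_one] at this
    rw [add_comm 1 x, ← this, ← Finset.sum_erase_add _ _ (Finset.empty_mem_powerset B)]
    simp
  linarith

lemma numeric_union (k d : ℕ) (hk : 1 ≤ k) (hd : d ≤ k) :
    (k : ℝ) * (2 * ((1 + 1 / ((k : ℝ) * (2 * k + 1))) ^ d - 1)) < 1 := by
  have hk' : (1 : ℝ) ≤ k := by exact_mod_cast hk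
  set x : ℝ := 1 / ((k : ℝ) * (2 * k + 1)) with hx
  have hx0 : 0 < x := by positivity
  have h1 : (1 + x) ^ d ≤ Real.exp (1 / (2 * k + 1)) := by
    calc (1 + x) ^ d ≤ (1 + x) ^ k := pow_le_pow_right₀ (by linarith) hd
      _ ≤ (Real.exp x) ^ k := pow_le_pow_left₀ (by linarith) (by linarith [Real.add_one_le_exp x]) _
      _ = Real.exp (1 / (2 * k + 1)) := by
        rw [← Real.exp_nat_mul]; congr 1; rw [hx]; field_simp
  have h2 : Real.exp (1 / (2 * k + 1)) < 1 + 1 / (2 * k) := by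
    have h3 := Real.add_one_lt_exp (x := -(1 / (2 * (k : ℝ) + 1))) (by
      have : (0 : ℝ) < 1 / (2 * k + 1) := by positivity
      linarith)
    rw [Real.exp_neg, lt_inv_comm₀ (by
      have : 1 / (2 * (k : ℝ) + 1) < 1 := by rw [div_lt_one (by positivity)]; linarith
      linarith) (Real.exp_pos _)] at h3
    have e : (-(1 / (2 * (k : ℝ) + 1)) + 1)⁻¹ = 1 + 1 / (2 * k) := by
      have : -(1 / (2 * (k : ℝ) + 1)) + 1 = 2 * k / (2 * k + 1) := by field_simp; ring
      rw [this]; field_simp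
    rwa [e] at h3
  calc (k : ℝ) * (2 * ((1 + x) ^ d - 1)) < k * (2 * (1 / (2 * k))) := by gcongr; linarith
    _ = 1 := by field_simp

theorem core {k : ℕ} (hk : 1 ≤ k) {ι : Type*} [Fintype ι] [DecidableEq ι]
    (r : ι → Fin k → ZMod 2) (hr : ∀ i, r i ≠ 0) (w : ι → ℝ) (hw : ∀ i, 0 < w i)
    {ε : ℝ} (h0 : 0 < ε) (hε : ε < 1) (N : ℕ)
    (hN : 3 * k * Real.log (k * (2 * k + 1)) / ε ^ 2 ≤ N) :
    ∃ (T : Finset ι) (v : ι → ℝ), (∀ i, 0 ≤ v i) ∧ T.card ≤ N ∧ (∀ i, i ∉ T → v i = 0) ∧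
      ∀ y : Fin k → ZMod 2,
        (1 - ε) * ∑ i ∈ univ.filter (fun i => y ⬝ᵥ r i ≠ 0), w i
          ≤ ∑ i ∈ univ.filter (fun i => y ⬝ᵥ r i ≠ 0), v i ∧
        ∑ i ∈ univ.filter (fun i => y ⬝ᵥ r i ≠ 0), v i
          ≤ (1 + ε) * ∑ i ∈ univ.filter (fun i => y ⬝ᵥ r i ≠ 0), w i := by
  classical
  rcases isEmpty_or_nonempty ι with hemp | hne
  · exact ⟨∅, fun _ => 0, by simp, by simp, by simp, by simp⟩
  obtain ⟨μ, hμ0, hμ1, u, hu, hupos, hopt⟩ := exists_packing (ZMod 2) r hr w hw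
  set κ : ι → ℝ := fun i => w i / u i with hκ
  have hκ0 : ∀ i, 0 < κ i := fun i => div_pos (hw i) (hupos i)
  have hκu : ∀ i, κ i * u i = w i := fun i => div_mul_cancel₀ _ (hupos i).ne'
  have hG : ∀ B, 0 < μ B → ∀ i, r i ∈ Submodule.span (ZMod 2)
      (r '' ((B.1.filter (fun b => κ i ≤ κ b) : Finset ι) : Set ι)) :=
    fun B hB i => greedy B.2 κ (hopt B hB) i
  set d := Module.finrank (ZMod 2) (Submodule.span (ZMod 2) (Set.range r)) with hd
  have hcard : ∀ B : {B : Finset ι // IsBas (ZMod 2) r B}, B.1.card = d := fun B => B.2.card_eq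
  have hdk : d ≤ k := by
    have := Submodule.finrank_le (Submodule.span (ZMod 2) (Set.range r))
    simpa using this
  have husum : ∀ c : Finset ι, ∑ i ∈ c, u i = ∑ B, μ B * ((c ∩ B.1).card : ℝ) := by
    intro c
    simp_rw [hu]
    rw [Finset.sum_comm]
    apply Finset.sum_congr rfl
    intro B _
    rw [← Finset.mul_sum]
    congr 1
    simp [Finset.sum_ite_mem]
  have hud : ∑ i, u i = d := by
    rw [husum]
    simp [hcard, ← Finset.sum_mul, hμ1]
  have hdpos : (0 : ℝ) < d := by
    rw [← hud]
    exact Finset.sum_pos (fun i _ => hupos i) Finset.univ_nonempty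
  have hkpos : (1 : ℝ) ≤ k := by exact_mod_cast hk
  obtain ⟨B0, hB0⟩ : ∃ B, 0 < μ B := by
    by_contra hcon
    push Not at hcon
    have : ∑ B, μ B ≤ 0 := Finset.sum_nonpos (fun B _ => hcon B)
    linarith
  set S : Finset ℝ := univ.image κ with hS
  have hScard : S.card ≤ k := by
    have : S ⊆ B0.1.image κ := by
      intro s hs
      obtain ⟨i, -, rfl⟩ := Finset.mem_image.1 hs
      have hB1 : ∃ B, 0 < μ B ∧ i ∈ B.1 := by
        by_contra hcon
        push Not at hcon
        have h1 := hupos i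
        rw [hu] at h1
        have : ∑ B, μ B * (if i ∈ B.1 then (1 : ℝ) else 0) ≤ 0 := by
          apply Finset.sum_nonpos
          intro B _
          split_ifs with h
          · by_contra h2
            exact hcon B (by linarith) h
          · simp
        linarith
      obtain ⟨B1, hB1, hi⟩ := hB1
      obtain ⟨b, hb, e⟩ := level_mem κ (hG B0 hB0) (hG B1 hB1) B1.2 i hi
      exact Finset.mem_image.2 ⟨b, hb, e⟩
    calc S.card ≤ (B0.1.image κ).card := Finset.card_le_card this
      _ ≤ B0.1.card := Finset.card_image_le
      _ ≤ k := by rw [hcard]; exact hdk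
  set C : ℝ → Finset (Finset ι) := fun s => ((univ : Finset (Fin k → ZMod 2)).image
        (fun y => univ.filter (fun i => y ⬝ᵥ r i ≠ 0 ∧ s ≤ κ i))).erase ∅ with hC
  set β := Real.log (k * (2 * k + 1)) with hβ
  set x : ℝ := 1 / (k * (2 * k + 1)) with hx
  have hβx : Real.exp (-β) = x := by
    rw [Real.exp_neg, hβ, Real.exp_log (by positivity), hx, one_div]
  have hβ0 : 0 ≤ β := Real.log_nonneg (by nlinarith)
  have hcount : ∀ s, ∑ c ∈ C s, Real.exp (-β * ∑ i ∈ c, u i) ≤ (1 + x) ^ d - 1 := by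
    intro s
    have hj : ∀ c : Finset ι, Real.exp (-β * ∑ i ∈ c, u i) ≤ ∑ B, μ B * x ^ (c ∩ B.1).card := by
      intro c
      have := convexOn_exp.map_sum_le (t := univ) (w := μ)
        (p := fun B => -β * ((c ∩ B.1).card : ℝ)) (fun B _ => hμ0 B) hμ1 (fun _ _ => trivial)
      simp only [smul_eq_mul] at this
      have e1 : -β * ∑ i ∈ c, u i = ∑ B, μ B * (-β * ((c ∩ B.1).card : ℝ)) := by
        rw [husum, Finset.mul_sum]
        exact Finset.sum_congr rfl (fun B _ => by ring)
      have e2 : ∀ B : {B : Finset ι // IsBas (ZMod 2) r B},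
          Real.exp (-β * ((c ∩ B.1).card : ℝ)) = x ^ (c ∩ B.1).card := by
        intro B
        rw [mul_comm, Real.exp_nat_mul, hβx]
      rw [e1]
      simpa only [e2] using this
    calc ∑ c ∈ C s, Real.exp (-β * ∑ i ∈ c, u i)
        ≤ ∑ c ∈ C s, ∑ B, μ B * x ^ (c ∩ B.1).card := Finset.sum_le_sum (fun c _ => hj c)
      _ = ∑ B, μ B * ∑ c ∈ C s, x ^ (c ∩ B.1).card := by
          rw [Finset.sum_comm]; simp_rw [Finset.mul_sum]
      _ ≤ ∑ B, μ B * ((1 + x) ^ d - 1) := by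
          apply Finset.sum_le_sum
          intro B _
          rcases (hμ0 B).eq_or_lt with h | h
          · rw [← h]; simp
          · have := count_bound r κ B.1 (hG B h) s x (by positivity)
            rw [hcard] at this
            exact mul_le_mul_of_nonneg_left this h.le
      _ = (1 + x) ^ d - 1 := by rw [← Finset.sum_mul, hμ1, one_mul]
  have hNpi : ∀ c : Finset ι, (N : ℝ) * ∑ i ∈ c, u i / d = N / d * ∑ i ∈ c, u i := by
    intro c; rw [← Finset.sum_div]; ring
  have hexp : ∀ c : Finset ι, Real.exp (-(N * ∑ i ∈ c, u i / d) * (ε ^ 2 / 3))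
      ≤ Real.exp (-β * ∑ i ∈ c, u i) := by
    intro c
    apply Real.exp_le_exp.2
    have hc0 : 0 ≤ ∑ i ∈ c, u i := Finset.sum_nonneg (fun i _ => (hupos i).le)
    have h1 : β ≤ N / d * (ε ^ 2 / 3) := by
      rw [div_le_iff₀ (by positivity)] at hN
      have h2 : 3 * (d : ℝ) * β ≤ 3 * k * β := by gcongr
      rw [div_mul_eq_mul_div, le_div_iff₀ hdpos]
      linarith
    rw [hNpi]
    have := mul_le_mul_of_nonneg_right h1 hc0
    linarith
  obtain ⟨ω, hω⟩ := sample_exists (τ := (_ : ℝ) × Finset ι) (fun i => u i / d)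
    (fun i => div_nonneg (hupos i).le hdpos.le)
    (by rw [← Finset.sum_div, hud, div_self hdpos.ne']) N (S.sigma C) (fun p => p.2) h0 hε (by
      rw [Finset.sum_sigma]
      calc ∑ s ∈ S, ∑ c ∈ C s, 2 * Real.exp (-(N * ∑ i ∈ c, u i / d) * (ε ^ 2 / 3))
          ≤ ∑ s ∈ S, 2 * ((1 + x) ^ d - 1) := by
            apply Finset.sum_le_sum
            intro s _
            rw [← Finset.mul_sum]
            have := (Finset.sum_le_sum (fun c (_ : c ∈ C s) => hexp c)).trans (hcount s)
            linarith
        _ = S.card * (2 * ((1 + x) ^ d - 1)) := by simp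
        _ ≤ k * (2 * ((1 + x) ^ d - 1)) := by
            have h1 : (1 : ℝ) ≤ (1 + x) ^ d := one_le_pow₀ (by
              have : 0 < x := by positivity
              linarith)
            have h2 : (S.card : ℝ) ≤ k := by exact_mod_cast hScard
            exact mul_le_mul_of_nonneg_right h2 (by linarith)
        _ < 1 := numeric_union k d hk hdk)
  have hN0 : (0 : ℝ) < N := by
    refine lt_of_lt_of_le ?_ hN
    have : 0 < Real.log ((k : ℝ) * (2 * k + 1)) := Real.log_pos (by nlinarith)
    positivity
  set h : ι → ℝ := fun i => ((univ.filter (fun j => ω j = i)).card : ℝ) with hh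
  have hhsum : ∀ c : Finset ι, ((univ.filter (fun j => ω j ∈ c)).card : ℝ) = ∑ i ∈ c, h i := by
    intro c
    simp only [hh]
    rw [Finset.card_eq_sum_card_fiberwise (f := ω) (t := c)]
    · push_cast
      apply Finset.sum_congr rfl
      intro i hi
      congr 2
      ext j
      simp only [Finset.mem_filter, Finset.mem_univ, true_and]
      constructor
      · rintro ⟨_, h⟩; exact h
      · rintro rfl; exact ⟨hi, rfl⟩
    · intro j hj; simpa using hj
  have hlev : ∀ (y : Fin k → ZMod 2) (l : ι),
      (1 - ε) * ∑ i ∈ univ.filter (fun i => y ⬝ᵥ r i ≠ 0 ∧ κ l ≤ κ i), u i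
        ≤ ∑ i ∈ univ.filter (fun i => y ⬝ᵥ r i ≠ 0 ∧ κ l ≤ κ i), d / N * h i ∧
      ∑ i ∈ univ.filter (fun i => y ⬝ᵥ r i ≠ 0 ∧ κ l ≤ κ i), d / N * h i
        ≤ (1 + ε) * ∑ i ∈ univ.filter (fun i => y ⬝ᵥ r i ≠ 0 ∧ κ l ≤ κ i), u i := by
    intro y l
    set c := univ.filter (fun i => y ⬝ᵥ r i ≠ 0 ∧ κ l ≤ κ i) with hc
    by_cases hce : c = ∅
    · rw [hce]; simp
    have := hω ⟨κ l, c⟩ (Finset.mem_sigma.2 ⟨Finset.mem_image_of_mem _ (Finset.mem_univ _),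
      Finset.mem_erase.2 ⟨hce, Finset.mem_image.2 ⟨y, Finset.mem_univ _, rfl⟩⟩⟩)
    simp only [hNpi, hhsum] at this
    rw [← Finset.mul_sum]
    have hdn : (0 : ℝ) < d / N := div_pos hdpos hN0
    have e : (d : ℝ) / N * (N / d) = 1 := by field_simp
    constructor
    · calc (1 - ε) * ∑ i ∈ c, u i = (d / N * (N / d)) * ((1 - ε) * ∑ i ∈ c, u i) := by
            rw [e, one_mul]
        _ = d / N * ((1 - ε) * (N / d * ∑ i ∈ c, u i)) := by ring
        _ ≤ _ := mul_le_mul_of_nonneg_left this.1 hdn.le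
    · calc d / N * ∑ i ∈ c, h i ≤ d / N * ((1 + ε) * (N / d * ∑ i ∈ c, u i)) :=
            mul_le_mul_of_nonneg_left this.2 hdn.le
        _ = (d / N * (N / d)) * ((1 + ε) * ∑ i ∈ c, u i) := by ring
        _ = _ := by rw [e, one_mul]
  refine ⟨univ.image ω, fun i => κ i * (d / N * h i), ?_, ?_, ?_, ?_⟩
  · intro i
    have := hκ0 i
    positivity
  · exact Finset.card_image_le.trans (by simp)
  · intro i hi
    have : h i = 0 := by
      simp only [hh, Nat.cast_eq_zero, Finset.card_eq_zero]
      rw [Finset.filter_eq_empty_iff]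
      intro j _ hj
      exact hi (Finset.mem_image.2 ⟨j, Finset.mem_univ _, hj⟩)
    simp [this]
  · intro y
    constructor
    · have := layer_cake (fun i => d / N * h i - (1 - ε) * u i)
        (univ.filter (fun i => y ⬝ᵥ r i ≠ 0)) κ (fun i _ => (hκ0 i).le) (by
          intro l _
          rw [Finset.filter_filter, Finset.sum_sub_distrib, ← Finset.mul_sum (a := 1 - ε)]
          linarith [(hlev y l).1])
      have e : ∑ i ∈ univ.filter (fun i => y ⬝ᵥ r i ≠ 0), κ i * (d / N * h i - (1 - ε) * u i)
          = ∑ i ∈ univ.filter (fun i => y ⬝ᵥ r i ≠ 0), κ i * (d / N * h i)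
            - (1 - ε) * ∑ i ∈ univ.filter (fun i => y ⬝ᵥ r i ≠ 0), w i := by
        rw [Finset.mul_sum, ← Finset.sum_sub_distrib]
        exact Finset.sum_congr rfl (fun i _ => by rw [← hκu i]; ring)
      linarith
    · have := layer_cake (fun i => (1 + ε) * u i - d / N * h i)
        (univ.filter (fun i => y ⬝ᵥ r i ≠ 0)) κ (fun i _ => (hκ0 i).le) (by
          intro l _
          rw [Finset.filter_filter, Finset.sum_sub_distrib, ← Finset.mul_sum (a := 1 + ε)]
          linarith [(hlev y l).2])
      have e : ∑ i ∈ univ.filter (fun i => y ⬝ᵥ r i ≠ 0), κ i * ((1 + ε) * u i - d / N * h i)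
          = (1 + ε) * ∑ i ∈ univ.filter (fun i => y ⬝ᵥ r i ≠ 0), w i
            - ∑ i ∈ univ.filter (fun i => y ⬝ᵥ r i ≠ 0), κ i * (d / N * h i) := by
        rw [Finset.mul_sum, ← Finset.sum_sub_distrib]
        exact Finset.sum_congr rfl (fun i _ => by rw [← hκu i]; ring)
      linarith

noncomputable def sgn2 (a : ZMod 2) : ℝ := if a = 0 then 1 else -1

lemma sgn2_add (a b : ZMod 2) : sgn2 (a + b) = sgn2 a * sgn2 b := by
  have h : ∀ a b : ZMod 2, (a + b = 0) ↔ ((a = 0 ∧ b = 0) ∨ (a ≠ 0 ∧ b ≠ 0)) := by decide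
  unfold sgn2
  by_cases ha : a = 0 <;> by_cases hb : b = 0 <;> simp [h, ha, hb]

lemma sgn2_orth {k : ℕ} (z : Fin k → ZMod 2) :
    ∑ y : Fin k → ZMod 2, sgn2 (y ⬝ᵥ z) = if z = 0 then (2 : ℝ) ^ k else 0 := by
  split_ifs with h
  · subst h; simp [sgn2]
  · obtain ⟨j, hj⟩ := Function.ne_iff.1 h
    have hs : ∑ y : Fin k → ZMod 2, sgn2 (y ⬝ᵥ z)
        = ∑ y : Fin k → ZMod 2, - sgn2 (y ⬝ᵥ z) := by
      apply Fintype.sum_equiv (Equiv.addRight (Pi.single j (1 : ZMod 2)))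
      intro y
      have h1 : sgn2 (z j) = -1 := by exact if_neg (by simpa using hj)
      simp [add_dotProduct, sgn2_add, h1]
    rw [Finset.sum_neg_distrib] at hs
    linarith

lemma add_eq_zero_zmod2 {k : ℕ} (u v : Fin k → ZMod 2) : u + v = 0 ↔ u = v := by
  have h : ∀ a b : ZMod 2, a + b = 0 ↔ a = b := by decide
  rw [funext_iff, funext_iff]
  exact forall_congr' (fun j => h _ _)

lemma cayley_psd (k n : ℕ) (r : Fin n → (Fin k → ZMod 2)) (a : Fin n → ℝ)
    (h : ∀ y : Fin k → ZMod 2, 0 ≤ ∑ i ∈ univ.filter (fun i => y ⬝ᵥ r i ≠ 0), a i) :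
    (cayleyLaplacian k n r a).PosSemidef := by
  have e : cayleyLaplacian k n r a = ∑ y : Fin k → ZMod 2,
      ((2 : ℝ) ^ k)⁻¹ • (2 * ∑ i ∈ univ.filter (fun i => y ⬝ᵥ r i ≠ 0), a i) •
        Matrix.vecMulVec (fun u => sgn2 (y ⬝ᵥ u)) (star (fun u => sgn2 (y ⬝ᵥ u))) := by
    ext u v
    have h1 : ∀ y : Fin k → ZMod 2, 2 * ∑ i ∈ univ.filter (fun i => y ⬝ᵥ r i ≠ 0), a i
        = ∑ i, a i * (1 - sgn2 (y ⬝ᵥ r i)) := by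
      intro y
      rw [Finset.mul_sum, Finset.sum_filter]
      apply Finset.sum_congr rfl
      intro i _
      unfold sgn2
      by_cases hy : y ⬝ᵥ r i = 0
      · simp [hy]
      · simp [hy]; ring
    have h2 : ∀ i, ∑ y : Fin k → ZMod 2, (1 - sgn2 (y ⬝ᵥ r i)) * sgn2 (y ⬝ᵥ (u + v))
        = 2 ^ k * ((if u = v then 1 else 0) - (if r i = u + v then 1 else 0)) := by
      intro i
      have : ∀ y : Fin k → ZMod 2, (1 - sgn2 (y ⬝ᵥ r i)) * sgn2 (y ⬝ᵥ (u + v))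
          = sgn2 (y ⬝ᵥ (u + v)) - sgn2 (y ⬝ᵥ (r i + (u + v))) := by
        intro y
        rw [dotProduct_add y (r i), sgn2_add]; ring
      rw [Finset.sum_congr rfl (fun y _ => this y), Finset.sum_sub_distrib, sgn2_orth, sgn2_orth]
      simp only [add_eq_zero_zmod2]
      split_ifs <;> ring
    simp only [Matrix.sum_apply, Matrix.smul_apply, Matrix.vecMulVec_apply, smul_eq_mul,
      star_trivial, h1, ← sgn2_add, ← dotProduct_add]
    rw [← Finset.mul_sum]
    simp_rw [Finset.sum_mul, mul_assoc]
    rw [Finset.sum_comm]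
    simp_rw [← Finset.mul_sum, h2]
    simp only [cayleyLaplacian, Matrix.of_apply]
    rw [Finset.sum_filter, Finset.sum_mul, ← Finset.sum_sub_distrib, Finset.mul_sum]
    apply Finset.sum_congr rfl
    intro i _
    field_simp
    split_ifs <;> ring
  rw [e]
  apply Matrix.posSemidef_sum
  intro y _
  refine Matrix.PosSemidef.smul (Matrix.PosSemidef.smul
    (Matrix.posSemidef_vecMulVec_self_star _) ?_) (by positivity)
  have := h y
  positivity

lemma cayley_sub_smul (k n : ℕ) (r : Fin n → (Fin k → ZMod 2)) (a b : Fin n → ℝ) (s t : ℝ) :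
    s • cayleyLaplacian k n r a - t • cayleyLaplacian k n r b
      = cayleyLaplacian k n r (fun i => s * a i - t * b i) := by
  ext u v
  simp only [cayleyLaplacian, Matrix.sub_apply, Matrix.smul_apply, Matrix.of_apply, smul_eq_mul,
    Finset.sum_sub_distrib, ← Finset.mul_sum]
  ring

lemma psd_both (k n : ℕ) (r : Fin n → (Fin k → ZMod 2)) (w v : Fin n → ℝ) (ε : ℝ)
    (h : ∀ y : Fin k → ZMod 2,
        (1 - ε) * ∑ i ∈ univ.filter (fun i => y ⬝ᵥ r i ≠ 0), w i
          ≤ ∑ i ∈ univ.filter (fun i => y ⬝ᵥ r i ≠ 0), v i ∧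
        ∑ i ∈ univ.filter (fun i => y ⬝ᵥ r i ≠ 0), v i
          ≤ (1 + ε) * ∑ i ∈ univ.filter (fun i => y ⬝ᵥ r i ≠ 0), w i) :
    (cayleyLaplacian k n r v - (1 - ε) • cayleyLaplacian k n r w).PosSemidef ∧
    ((1 + ε) • cayleyLaplacian k n r w - cayleyLaplacian k n r v).PosSemidef := by
  have h1 := cayley_sub_smul k n r v w 1 (1 - ε)
  have h2 := cayley_sub_smul k n r w v (1 + ε) 1
  rw [one_smul] at h1 h2
  rw [h1, h2]
  constructor
  · apply cayley_psd
    intro y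
    rw [Finset.sum_sub_distrib, ← Finset.mul_sum, ← Finset.mul_sum]
    linarith [(h y).1]
  · apply cayley_psd
    intro y
    rw [Finset.sum_sub_distrib, ← Finset.mul_sum, ← Finset.mul_sum]
    linarith [(h y).2]

/-- Merging parallel generators, keeping only the vectors in `Z`. -/
lemma merge (k n : ℕ) (r : Fin n → (Fin k → ZMod 2)) (w : Fin n → ℝ) (Z : Finset (Fin k → ZMod 2)) :
    ∃ T : Finset (Fin n), T.card ≤ Z.card ∧ ∀ y : Fin k → ZMod 2,
      ∑ i ∈ univ.filter (fun i => y ⬝ᵥ r i ≠ 0),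
        (if i ∈ T then ∑ l ∈ univ.filter (fun l => r l = r i), w l else 0)
      = ∑ v ∈ Z.filter (fun v => y ⬝ᵥ v ≠ 0), ∑ l ∈ univ.filter (fun l => r l = v), w l := by
  classical
  set Z' := Z.filter (fun v => ∃ i, r i = v) with hZ'
  have hex : ∀ v : Z', ∃ i, r i = v.1 := fun v => (Finset.mem_filter.1 v.2).2
  choose f hf using hex
  have hfinj : Function.Injective f := by
    intro a b hab
    apply Subtype.ext
    rw [← hf a, ← hf b, hab]
  refine ⟨univ.image f, ?_, ?_⟩
  · refine Finset.card_image_le.trans ?_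
    simp only [Finset.card_univ, Fintype.card_coe]
    exact Finset.card_filter_le _ _
  · intro y
    rw [← Finset.sum_filter, Finset.filter_filter]
    have h1 : ∑ v ∈ Z.filter (fun v => y ⬝ᵥ v ≠ 0), ∑ l ∈ univ.filter (fun l => r l = v), w l
        = ∑ v ∈ Z'.filter (fun v => y ⬝ᵥ v ≠ 0), ∑ l ∈ univ.filter (fun l => r l = v), w l := by
      symm
      apply Finset.sum_subset
      · exact Finset.filter_subset_filter _ (Finset.filter_subset _ _)
      · intro v hv hv'
        have : ¬ ∃ i, r i = v := by
          intro hi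
          apply hv'
          simp only [Finset.mem_filter] at hv
          simp only [hZ', Finset.mem_filter]
          exact ⟨⟨hv.1, hi⟩, hv.2⟩
        apply Finset.sum_eq_zero
        intro l hl
        exact absurd ⟨l, (Finset.mem_filter.1 hl).2⟩ this
    rw [h1]
    apply Finset.sum_bij (fun i _ => r i)
    · intro i hi
      simp only [Finset.mem_filter, Finset.mem_univ, true_and, Finset.mem_image] at hi
      obtain ⟨hy, v, rfl⟩ := hi
      rw [hf] at hy ⊢
      exact Finset.mem_filter.2 ⟨v.2, hy⟩
    · intro i hi j hj hij
      simp only [Finset.mem_filter, Finset.mem_univ, true_and, Finset.mem_image] at hi hj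
      obtain ⟨-, a, rfl⟩ := hi
      obtain ⟨-, b, rfl⟩ := hj
      rw [hf, hf] at hij
      rw [Subtype.ext hij]
    · intro v hv
      have hv' := Finset.mem_filter.1 hv
      refine ⟨f ⟨v, hv'.1⟩, ?_, hf _⟩
      simp only [Finset.mem_filter, Finset.mem_univ, true_and, Finset.mem_image]
      refine ⟨?_, _, rfl⟩
      rw [hf]; exact hv'.2
    · intro i _; rfl

lemma total_eq (k n : ℕ) (r : Fin n → (Fin k → ZMod 2)) (w : Fin n → ℝ) (y : Fin k → ZMod 2) :
    ∑ i ∈ univ.filter (fun i => y ⬝ᵥ r i ≠ 0), w i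
      = ∑ v ∈ univ.filter (fun v => y ⬝ᵥ v ≠ 0), ∑ l ∈ univ.filter (fun l => r l = v), w l := by
  rw [← Finset.sum_fiberwise_of_maps_to (g := r) (t := univ.filter (fun v => y ⬝ᵥ v ≠ 0))]
  · apply Finset.sum_congr rfl
    intro v hv
    have hv' := (Finset.mem_filter.1 hv).2
    apply Finset.sum_congr _ (fun _ _ => rfl)
    ext l
    simp only [Finset.mem_filter, Finset.mem_univ, true_and]
    constructor
    · rintro ⟨_, h⟩; exact h
    · rintro rfl; exact ⟨hv', rfl⟩
  · intro i hi
    simpa using hi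

lemma small_case (k n : ℕ) (r : Fin n → (Fin k → ZMod 2)) (w : Fin n → ℝ) (hw : ∀ i, 0 < w i)
    (ε : ℝ) (h0 : 0 < ε) :
    ∃ (T : Finset (Fin n)) (v : Fin n → ℝ), (∀ i, 0 ≤ v i) ∧ T.card ≤ 2 ^ k - 1 ∧
      (cayleyLaplacian k n r (fun i => if i ∈ T then v i else 0)
          - (1 - ε) • cayleyLaplacian k n r w).PosSemidef ∧
      ((1 + ε) • cayleyLaplacian k n r w
          - cayleyLaplacian k n r (fun i => if i ∈ T then v i else 0)).PosSemidef := by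
  classical
  obtain ⟨T, hT, h⟩ := merge k n r w (univ.erase 0)
  refine ⟨T, fun i => ∑ l ∈ univ.filter (fun l => r l = r i), w l,
    fun i => Finset.sum_nonneg (fun l _ => (hw l).le), ?_, ?_⟩
  · rw [Finset.card_erase_of_mem (Finset.mem_univ _)] at hT
    simpa using hT
  · apply psd_both
    intro y
    have e : (univ.erase (0 : Fin k → ZMod 2)).filter (fun v => y ⬝ᵥ v ≠ 0)
        = univ.filter (fun v => y ⬝ᵥ v ≠ 0) := by
      ext v
      simp only [Finset.mem_filter, Finset.mem_erase, Finset.mem_univ, and_true, true_and,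
        and_iff_right_iff_imp]
      rintro hv rfl
      simp at hv
    rw [h y, e, ← total_eq]
    have : 0 ≤ ∑ i ∈ univ.filter (fun i => y ⬝ᵥ r i ≠ 0), w i :=
      Finset.sum_nonneg (fun l _ => (hw l).le)
    constructor <;> nlinarith

lemma two_case (n : ℕ) (r : Fin n → (Fin 2 → ZMod 2)) (w : Fin n → ℝ) (hw : ∀ i, 0 < w i)
    (ε : ℝ) (h0 : 1 / 2 ≤ ε) :
    ∃ (T : Finset (Fin n)) (v : Fin n → ℝ), (∀ i, 0 ≤ v i) ∧ T.card ≤ 2 ∧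
      (cayleyLaplacian 2 n r (fun i => if i ∈ T then v i else 0)
          - (1 - ε) • cayleyLaplacian 2 n r w).PosSemidef ∧
      ((1 + ε) • cayleyLaplacian 2 n r w
          - cayleyLaplacian 2 n r (fun i => if i ∈ T then v i else 0)).PosSemidef := by
  classical
  set W : (Fin 2 → ZMod 2) → ℝ := fun v => ∑ l ∈ univ.filter (fun l => r l = v), w l with hW
  have hW0 : ∀ v, 0 ≤ W v := fun v => Finset.sum_nonneg (fun l _ => (hw l).le)
  obtain ⟨v0, hv0, hmin⟩ := Finset.exists_min_image (univ.erase (0 : Fin 2 → ZMod 2)) W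
    ⟨1, by decide⟩
  obtain ⟨T, hT, h⟩ := merge 2 n r w ((univ.erase 0).erase v0)
  refine ⟨T, fun i => ∑ l ∈ univ.filter (fun l => r l = r i), w l,
    fun i => Finset.sum_nonneg (fun l _ => (hw l).le), ?_, ?_⟩
  · rw [Finset.card_erase_of_mem hv0, Finset.card_erase_of_mem (Finset.mem_univ _)] at hT
    simpa using hT
  · apply psd_both
    intro y
    have e : ((univ.erase (0 : Fin 2 → ZMod 2)).erase v0).filter (fun v => y ⬝ᵥ v ≠ 0)
        = (univ.filter (fun v => y ⬝ᵥ v ≠ 0)).erase v0 := by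
      ext v
      simp only [Finset.mem_filter, Finset.mem_erase, Finset.mem_univ, and_true, true_and,
        and_assoc]
      constructor
      · rintro ⟨h1, h2, h3⟩; exact ⟨h1, h3⟩
      · rintro ⟨h1, h3⟩
        refine ⟨h1, ?_, h3⟩
        rintro rfl
        simp at h3
    rw [h y, e, total_eq]
    change (1 - ε) * ∑ v ∈ univ.filter (fun v => y ⬝ᵥ v ≠ 0), W v
      ≤ ∑ v ∈ (univ.filter (fun v => y ⬝ᵥ v ≠ 0)).erase v0, W v ∧
      ∑ v ∈ (univ.filter (fun v => y ⬝ᵥ v ≠ 0)).erase v0, W v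
      ≤ (1 + ε) * ∑ v ∈ univ.filter (fun v => y ⬝ᵥ v ≠ 0), W v
    have hn : 0 ≤ ∑ v ∈ univ.filter (fun v => y ⬝ᵥ v ≠ 0), W v :=
      Finset.sum_nonneg (fun v _ => hW0 v)
    by_cases hy : y ⬝ᵥ v0 = 0
    · have hnm : v0 ∉ univ.filter (fun v => y ⬝ᵥ v ≠ 0) := fun hm => (Finset.mem_filter.1 hm).2 hy
      rw [Finset.erase_eq_of_notMem hnm]
      constructor <;> nlinarith
    · have hex : ∀ y v0 : Fin 2 → ZMod 2, y ⬝ᵥ v0 ≠ 0 → ∃ v1, v1 ≠ v0 ∧ v1 ≠ 0 ∧ y ⬝ᵥ v1 ≠ 0 := by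
        decide
      obtain ⟨v1, hv1, hv10, hy1⟩ := hex y v0 hy
      have hle := hmin v1 (by simp [hv10])
      rw [← Finset.sum_erase_add _ _ (show v0 ∈ univ.filter (fun v => y ⬝ᵥ v ≠ 0) from
        Finset.mem_filter.2 ⟨Finset.mem_univ _, hy⟩)]
      have hge : W v1 ≤ ∑ v ∈ (univ.filter (fun v => y ⬝ᵥ v ≠ 0)).erase v0, W v :=
        Finset.single_le_sum (f := W) (fun v _ => hW0 v)
          (Finset.mem_erase.2 ⟨hv1, Finset.mem_filter.2 ⟨Finset.mem_univ _, hy1⟩⟩)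
      have := hW0 v0
      have := hW0 v1
      constructor <;> nlinarith

lemma main_case (k n : ℕ) (hk : 1 ≤ k) (r : Fin n → (Fin k → ZMod 2)) (w : Fin n → ℝ)
    (hw : ∀ i, 0 < w i) (ε : ℝ) (h0 : 0 < ε) (hε : ε < 1) (N : ℕ)
    (hN : 3 * k * Real.log (k * (2 * k + 1)) / ε ^ 2 ≤ N) :
    ∃ (T : Finset (Fin n)) (v : Fin n → ℝ), (∀ i, 0 ≤ v i) ∧ T.card ≤ N ∧
      (cayleyLaplacian k n r (fun i => if i ∈ T then v i else 0)
          - (1 - ε) • cayleyLaplacian k n r w).PosSemidef ∧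
      ((1 + ε) • cayleyLaplacian k n r w
          - cayleyLaplacian k n r (fun i => if i ∈ T then v i else 0)).PosSemidef := by
  classical
  obtain ⟨T, v, hv0, hT, hvT, h⟩ := core hk (fun i : {i : Fin n // r i ≠ 0} => r i.1)
    (fun i => i.2) (fun i => w i.1) (fun i => hw i.1) h0 hε N hN
  refine ⟨T.map (Function.Embedding.subtype _), fun i => if hi : r i ≠ 0 then v ⟨i, hi⟩ else 0,
    ?_, ?_, ?_⟩
  · intro i
    dsimp only
    split_ifs
    · exact hv0 _
    · exact le_rfl
  · rwa [Finset.card_map]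
  · apply psd_both
    intro y
    have key : ∀ (f : Fin n → ℝ), ∑ i ∈ univ.filter (fun i => y ⬝ᵥ r i ≠ 0), f i
        = ∑ i ∈ univ.filter (fun i : {i : Fin n // r i ≠ 0} => y ⬝ᵥ r i.1 ≠ 0), f i.1 := by
      intro f
      symm
      apply Finset.sum_bij (fun i _ => i.1)
      · intro i hi; simpa using hi
      · intro i _ j _ hij; exact Subtype.ext hij
      · intro i hi
        have hi' := (Finset.mem_filter.1 hi).2
        refine ⟨⟨i, ?_⟩, by simpa using hi', rfl⟩
        intro h0
        rw [h0] at hi'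
        simp at hi'
      · intro i _; rfl
    rw [key, key]
    have e : ∀ i : {i : Fin n // r i ≠ 0}, (if i.1 ∈ T.map (Function.Embedding.subtype _) then
        (if hi : r i.1 ≠ 0 then v ⟨i.1, hi⟩ else 0) else 0) = v i := by
      intro i
      by_cases hi : i ∈ T
      · have : i.1 ∈ T.map (Function.Embedding.subtype _) :=
          Finset.mem_map.2 ⟨i, hi, rfl⟩
        rw [if_pos this, dif_pos i.2]
      · have : i.1 ∉ T.map (Function.Embedding.subtype _) := by
          intro hm
          obtain ⟨j, hj, hij⟩ := Finset.mem_map.1 hm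
          exact hi (Subtype.ext hij ▸ hj)
        rw [if_neg this, hvT i hi]
    rw [Finset.sum_congr rfl (fun i _ => e i)]
    exact h y

lemma le_rpow_fifth {a y : ℝ} (m : ℕ) (hy : 0 ≤ y) (h : a ^ 5 ≤ y ^ m) :
    a ≤ y ^ ((m : ℝ) / 5) := by
  have e : (y ^ ((m : ℝ) / 5)) ^ 5 = y ^ m := by
    rw [← Real.rpow_natCast, ← Real.rpow_mul hy, ← Real.rpow_natCast y m]
    congr 1
    push_cast
    ring
  rw [← e] at h
  by_contra hcon
  push Not at hcon
  have := pow_lt_pow_left₀ hcon (Real.rpow_nonneg hy _) (n := 5) (by norm_num)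
  linarith

lemma bound_ge (k : ℕ) (hk : 2 ≤ k) {ε : ℝ} (h0 : 0 < ε) (h1 : ε < 1) {c X : ℝ} (hc : 0 < c)
    (hc' : c ≤ Real.log (k / ε)) (hX : X ≤ 14 / 5 * k * c ^ (14 / 5 : ℝ)) :
    X ≤ 14 / 5 * k * (Real.log ((k : ℝ) / ε)) ^ (14 / 5 : ℝ) / ε ^ 2 := by
  have h2 : c ^ (14 / 5 : ℝ) ≤ (Real.log ((k : ℝ) / ε)) ^ (14 / 5 : ℝ) :=
    Real.rpow_le_rpow hc.le hc' (by norm_num)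
  have h3 : X ≤ 14 / 5 * k * (Real.log ((k : ℝ) / ε)) ^ (14 / 5 : ℝ) := hX.trans (by gcongr)
  refine h3.trans ?_
  apply le_div_self _ (by positivity) (by nlinarith)
  have : 0 ≤ (Real.log ((k : ℝ) / ε)) ^ (14 / 5 : ℝ) :=
    (Real.rpow_nonneg hc.le _).trans h2
  positivity

lemma log_ge (k : ℕ) (hk : 2 ≤ k) {ε : ℝ} (h0 : 0 < ε) (h1 : ε < 1) :
    Real.log k ≤ Real.log (k / ε) := by
  have hk' : (0 : ℝ) < k := by
    have : 0 < k := by omega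
    exact_mod_cast this
  exact Real.log_le_log hk' (le_div_self hk'.le h0 h1.le)

lemma log4_ge : (1.386 : ℝ) ≤ Real.log 4 := by
  have : (4 : ℝ) = 2 ^ 2 := by norm_num
  rw [this, Real.log_pow]
  have := Real.log_two_gt_d9
  push_cast
  linarith

lemma log6_ge : (7 / 4 : ℝ) ≤ Real.log 6 := by
  have h : (7 : ℝ) ≤ Real.log (6 ^ 4) := by
    rw [Real.le_log_iff_exp_le (by norm_num)]
    have e : Real.exp 7 = Real.exp 1 ^ 7 := by
      rw [← Real.exp_nat_mul]; norm_num
    rw [e]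
    calc Real.exp 1 ^ 7 ≤ 2.7182818286 ^ 7 :=
          pow_le_pow_left₀ (Real.exp_pos _).le Real.exp_one_lt_d9.le _
      _ ≤ 6 ^ 4 := by norm_num
  rw [Real.log_pow] at h
  push_cast at h
  linarith

lemma big_numeric (k : ℕ) (hk : 6 ≤ k) {ε : ℝ} (h0 : 0 < ε) (h1 : ε < 1) :
    3 * k * Real.log (k * (2 * k + 1)) / ε ^ 2 + 1
      ≤ 14 / 5 * k * (Real.log ((k : ℝ) / ε)) ^ (14 / 5 : ℝ) / ε ^ 2 := by
  have hk' : (6 : ℝ) ≤ k := by exact_mod_cast hk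
  have hlk := log_ge k (by omega) h0 h1
  set x := Real.log k with hx
  have hx1 : 7 / 4 ≤ x := log6_ge.trans (Real.log_le_log (by norm_num) hk')
  have hx0 : 0 < x := by linarith
  have h2 : Real.log ((k : ℝ) * (2 * k + 1)) ≤ 2 * x + 0.7766 := by
    have e1 : (k : ℝ) * (2 * k + 1) ≤ k * k * 2 * (13 / 12) := by nlinarith
    calc Real.log ((k : ℝ) * (2 * k + 1)) ≤ Real.log (k * k * 2 * (13 / 12)) :=
          Real.log_le_log (by positivity) e1
      _ = x + x + Real.log 2 + Real.log (13 / 12) := by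
          rw [Real.log_mul (by positivity) (by norm_num), Real.log_mul (by positivity) (by norm_num),
            Real.log_mul (by positivity) (by positivity)]
      _ ≤ _ := by
          have := Real.log_two_lt_d9
          have := Real.log_le_sub_one_of_pos (show (0 : ℝ) < 13 / 12 by norm_num)
          linarith
  have h3 : x * 2.7 ≤ x ^ (14 / 5 : ℝ) := by
    have e : (14 / 5 : ℝ) = 1 + ((9 : ℕ) : ℝ) / 5 := by norm_num
    rw [e, Real.rpow_add hx0, Real.rpow_one]
    apply mul_le_mul_of_nonneg_left _ hx0.le
    apply le_rpow_fifth 9 hx0.le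
    calc (2.7 : ℝ) ^ 5 ≤ (7 / 4) ^ 9 := by norm_num
      _ ≤ x ^ 9 := pow_le_pow_left₀ (by norm_num) hx1 _
  have h4 : x ^ (14 / 5 : ℝ) ≤ (Real.log ((k : ℝ) / ε)) ^ (14 / 5 : ℝ) :=
    Real.rpow_le_rpow hx0.le hlk (by norm_num)
  have hε2 : ε ^ 2 ≤ 1 := by nlinarith
  have h5 : 3 * k * Real.log (k * (2 * k + 1)) + ε ^ 2
      ≤ 14 / 5 * k * (Real.log ((k : ℝ) / ε)) ^ (14 / 5 : ℝ) := by
    have h6 : 3 * Real.log ((k : ℝ) * (2 * k + 1)) + 1 / 6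
        ≤ 14 / 5 * (Real.log ((k : ℝ) / ε)) ^ (14 / 5 : ℝ) := by
      norm_num at h2 h3 ⊢
      linarith
    have h7 := mul_le_mul_of_nonneg_left h6 (show (0 : ℝ) ≤ k by linarith)
    linarith
  rw [le_div_iff₀ (by positivity), add_mul, div_mul_cancel₀ _ (by positivity)]
  linarith

end Helpers

/-- Every weighted Cayley graph over `F₂^k` has a spectral sparsifier that
is again a Cayley graph, generated by at most `C · k · (log(k/ε))^C / ε²` of the
original generators with new nonnegative weights. -/
theorem cayley_graph_sparsification :
    ∃ C : ℝ, 0 < C ∧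
      ∀ (k n : ℕ), 2 ≤ k →
        ∀ ε : ℝ, ε ∈ Set.Ioo (0 : ℝ) 1 →
          ∀ (r : Fin n → (Fin k → ZMod 2)) (w : Fin n → ℝ), (∀ i, 0 < w i) →
            ∃ (T : Finset (Fin n)) (w2 : Fin n → ℝ),
              (∀ i, 0 ≤ w2 i) ∧
              (T.card : ℝ) ≤ C * k * (Real.log ((k : ℝ) / ε)) ^ C / ε ^ 2 ∧
              (cayleyLaplacian k n r (fun i => if i ∈ T then w2 i else 0)
                  - (1 - ε) • cayleyLaplacian k n r w).PosSemidef ∧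
              ((1 + ε) • cayleyLaplacian k n r w
                  - cayleyLaplacian k n r (fun i => if i ∈ T then w2 i else 0)).PosSemidef := by
  refine ⟨14 / 5, by norm_num, ?_⟩
  intro k n hk ε hε r w hw
  obtain ⟨h0, h1⟩ := hε
  by_cases hk6 : 6 ≤ k
  · -- the main case: sampling along an optimal fractional base packing
    have hnn : 0 ≤ 3 * k * Real.log (k * (2 * k + 1)) / ε ^ 2 := by
      have hk' : (6 : ℝ) ≤ k := by exact_mod_cast hk6
      have : 0 ≤ Real.log ((k : ℝ) * (2 * k + 1)) := Real.log_nonneg (by nlinarith)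
      positivity
    obtain ⟨T, v, hv, hT, hpsd⟩ := main_case k n (by omega) r w hw ε h0 h1
      ⌈3 * k * Real.log (k * (2 * k + 1)) / ε ^ 2⌉₊ (Nat.le_ceil _)
    refine ⟨T, v, hv, ?_, hpsd⟩
    have hT' : (T.card : ℝ) ≤ (⌈3 * k * Real.log (k * (2 * k + 1)) / ε ^ 2⌉₊ : ℝ) := by
      exact_mod_cast hT
    exact hT'.trans ((Nat.ceil_lt_add_one hnn).le.trans (big_numeric k hk6 h0 h1))
  by_cases hsp : k = 2 ∧ 1 / 2 ≤ ε
  · obtain ⟨rfl, hε2⟩ := hsp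
    obtain ⟨T, v, hv, hT, hpsd⟩ := two_case n r w hw ε hε2
    refine ⟨T, v, hv, ?_, hpsd⟩
    have hT' : (T.card : ℝ) ≤ 2 := by exact_mod_cast hT
    refine hT'.trans (bound_ge 2 le_rfl h0 h1 (c := 0.6931) (by norm_num) ?_ ?_)
    · refine le_trans ?_ (log_ge 2 le_rfl h0 h1)
      have := Real.log_two_gt_d9
      push_cast
      linarith
    · have := le_rpow_fifth (a := 0.3572) (y := 0.6931) 14 (by norm_num) (by norm_num)
      push_cast at this ⊢
      linarith
  · obtain ⟨T, v, hv, hT, hpsd⟩ := small_case k n r w hw ε h0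
    refine ⟨T, v, hv, ?_, hpsd⟩
    have h4 := log4_ge
    have hr4 := le_rpow_fifth (a := 2.3) (y := 1.386) 14 (by norm_num) (by norm_num)
    push_cast at hr4
    have hk5 : k < 6 := by omega
    interval_cases k
    · have hlt : ε < 1 / 2 := by
        by_contra h
        exact hsp ⟨rfl, not_lt.1 h⟩
      have hT' : (T.card : ℝ) ≤ 3 := by exact_mod_cast hT
      refine hT'.trans (bound_ge 2 le_rfl h0 h1 (c := 1.386) (by norm_num) ?_ ?_)
      · refine h4.trans (Real.log_le_log (by norm_num) ?_)
        rw [le_div_iff₀ h0]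
        push_cast
        linarith
      · push_cast
        linarith
    · have hT' : (T.card : ℝ) ≤ 7 := by exact_mod_cast hT
      refine hT'.trans (bound_ge 3 (by norm_num) h0 h1 (c := 1) (by norm_num) ?_ ?_)
      · refine le_trans ?_ (log_ge 3 (by norm_num) h0 h1)
        rw [Real.le_log_iff_exp_le (by norm_num)]
        have := Real.exp_one_lt_d9
        push_cast
        linarith
      · rw [Real.one_rpow]; norm_num
    · have hT' : (T.card : ℝ) ≤ 15 := by exact_mod_cast hT
      refine hT'.trans (bound_ge 4 (by norm_num) h0 h1 (c := 1.386) (by norm_num) ?_ ?_)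
      · exact le_trans (by exact_mod_cast h4) (log_ge 4 (by norm_num) h0 h1)
      · push_cast
        linarith
    · have hT' : (T.card : ℝ) ≤ 31 := by exact_mod_cast hT
      refine hT'.trans (bound_ge 5 (by norm_num) h0 h1 (c := 1.386) (by norm_num) ?_ ?_)
      · refine h4.trans (le_trans ?_ (log_ge 5 (by norm_num) h0 h1))
        exact Real.log_le_log (by norm_num) (by norm_num)
      · push_cast
        linarith
end

section
/- Let k ≥ 2 be an integer and let ε ∈ [0,1). Consider the instance of CSP(AND) on Boolean variables x_1,…,x_k whose constraints are x_i ∧ x_j for every unordered pair {i,j} of distinct indices in {1,…,k}. Suppose T is a set of unordered pairs of distinct indices and (w_{ij})_{{i,j}∈T} are nonnegative real weights such that for every assignment a : {1,…,k} → {0,1}, (1−ε)·N(a) ≤ Σ_{{i,j}∈T : a(i)=a(j)=1} w_{ij} ≤ (1+ε)·N(a), where N(a) = |{unordered pairs {i,j}, i≠j : a(i)=a(j)=1}|. Then every unordered pair {i,j} of distinct indices in {1,…,k} belongs to T and has w_{ij} > 0; in particular |T| ≥ binom(k,2). -/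
/-- Any `(1 ± ε)`-sparsifier (with `ε < 1`) of the complete CSP(AND)
instance on `k ≥ 2` Boolean variables, whose constraints are `x_i ∧ x_j` for all
unordered pairs of distinct indices, must keep every pair with positive weight;
in particular it has at least `C(k,2)` constraints. -/
theorem complete_and_instance_lower_bound
    (k : ℕ) (hk : 2 ≤ k) (ε : ℝ) (hε : ε ∈ Set.Ico (0 : ℝ) 1)
    (T : Finset (Finset (Fin k))) (hT : ∀ e ∈ T, e.card = 2)
    (w : Finset (Fin k) → ℝ) (hw : ∀ e ∈ T, 0 ≤ w e)
    (happrox : ∀ a : Fin k → Bool,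
      (1 - ε) *
          ((Finset.univ.filter
            (fun e : Finset (Fin k) => e.card = 2 ∧ ∀ i ∈ e, a i = true)).card : ℝ)
        ≤ (∑ e ∈ T.filter (fun e => ∀ i ∈ e, a i = true), w e) ∧
      (∑ e ∈ T.filter (fun e => ∀ i ∈ e, a i = true), w e)
        ≤ (1 + ε) *
          ((Finset.univ.filter
            (fun e : Finset (Fin k) => e.card = 2 ∧ ∀ i ∈ e, a i = true)).card : ℝ)) :
    (∀ e : Finset (Fin k), e.card = 2 → e ∈ T ∧ 0 < w e) ∧ k.choose 2 ≤ T.card := by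
  have main : ∀ e : Finset (Fin k), e.card = 2 → e ∈ T ∧ 0 < w e := by
    intro e he
    have h := (happrox (fun i => decide (i ∈ e))).1
    have key : ∀ f : Finset (Fin k), f.card = 2 →
        (∀ i ∈ f, decide (i ∈ e) = true) → f = e := by
      intro f hf hfe
      apply Finset.eq_of_subset_of_card_le
      · intro i hi
        simpa using hfe i hi
      · omega
    have hN : (Finset.univ.filter (fun f : Finset (Fin k) =>
        f.card = 2 ∧ ∀ i ∈ f, decide (i ∈ e) = true)) = {e} := by
      ext f
      simp only [Finset.mem_filter, Finset.mem_univ, true_and, Finset.mem_singleton]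
      constructor
      · rintro ⟨h1, h2⟩
        exact key f h1 h2
      · rintro rfl
        exact ⟨he, fun i hi => by simpa using hi⟩
    rw [hN, Finset.card_singleton] at h
    have hpos : (0 : ℝ) < 1 - ε := by linarith [hε.2]
    by_cases heT : e ∈ T
    · have hS : T.filter (fun f => ∀ i ∈ f, decide (i ∈ e) = true) = {e} := by
        ext f
        simp only [Finset.mem_filter, Finset.mem_singleton]
        constructor
        · rintro ⟨h1, h2⟩
          exact key f (hT f h1) h2
        · rintro rfl
          exact ⟨heT, fun i hi => by simpa using hi⟩
      rw [hS, Finset.sum_singleton] at h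
      refine ⟨heT, ?_⟩
      push_cast at h
      linarith
    · exfalso
      have hS : T.filter (fun f => ∀ i ∈ f, decide (i ∈ e) = true) = ∅ := by
        apply Finset.filter_eq_empty_iff.mpr
        intro f hf h2
        exact heT (key f (hT f hf) h2 ▸ hf)
      rw [hS, Finset.sum_empty] at h
      push_cast at h
      linarith
  refine ⟨main, ?_⟩
  have hc : (Finset.powersetCard 2 (Finset.univ : Finset (Fin k))).card = k.choose 2 := by
    simp
  rw [← hc]
  apply Finset.card_le_card
  intro e he
  exact (main e (Finset.mem_powersetCard.mp he).2).1
end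

section
/- Let r ≥ 2 and let P : {0,1}^r → {0,1} be a predicate with an affine projection to AND. Then for every integer k ≥ 2 and every ε ∈ [0,1), there exists an instance of CSP(P) on 2rk + 2 Boolean variables with exactly binom(k,2) constraints (each constraint being an r-tuple of variable indices, satisfied by an assignment a exactly when P applied to the corresponding values of a equals 1) such that: for every subset T of the constraints and nonnegative weights (w_j)_{j∈T} satisfying, for every Boolean assignment a of the 2rk+2 variables, (1−ε)·(number of constraints satisfied by a) ≤ Σ_{j∈T : constraint j satisfied by a} w_j ≤ (1+ε)·(number of constraints satisfied by a), it holds that T contains all binom(k,2) constraints. In particular, every (1±ε)-sparsifier of this instance has size at least binom(k,2). -/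
/-- `g : {0,1}² → {0,1}` is one of the six affine-projection functions
`0, 1, x, ¬x, y, ¬y`. -/
def IsAffineProjFun (g : Bool → Bool → Bool) : Prop :=
  (∀ x y, g x y = false) ∨ (∀ x y, g x y = true) ∨ (∀ x y, g x y = x) ∨
    (∀ x y, g x y = !x) ∨ (∀ x y, g x y = y) ∨ (∀ x y, g x y = !y)

/-- A predicate `P : {0,1}^r → {0,1}` has an affine projection to AND. -/
def HasAffineProjToAND {r : ℕ} (P : (Fin r → Bool) → Bool) : Prop :=
  ∃ g : Fin r → Bool → Bool → Bool,
    (∀ t, IsAffineProjFun (g t)) ∧ ∀ x y : Bool, P (fun t => g t x y) = (x && y)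

/-- Value of a variable (literal `x_i` / `¬ x_i`, or a constant) under `x`. -/
def litVal {k : ℕ} (x : Fin k → Bool) : (Fin k × Bool) ⊕ Bool → Bool
  | Sum.inl (i, b) => if b then x i else !(x i)
  | Sum.inr b => b

lemma exists_lit {g : Bool → Bool → Bool} (hg : IsAffineProjFun g) {k : ℕ} (p q : Fin k) :
    ∃ v : (Fin k × Bool) ⊕ Bool, ∀ x : Fin k → Bool, litVal x v = g (x p) (x q) := by
  rcases hg with h | h | h | h | h | h
  · exact ⟨Sum.inr false, fun x => by simp [litVal, h]⟩
  · exact ⟨Sum.inr true, fun x => by simp [litVal, h]⟩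
  · exact ⟨Sum.inl (p, true), fun x => by simp [litVal, h]⟩
  · exact ⟨Sum.inl (p, false), fun x => by simp [litVal, h]⟩
  · exact ⟨Sum.inl (q, true), fun x => by simp [litVal, h]⟩
  · exact ⟨Sum.inl (q, false), fun x => by simp [litVal, h]⟩

lemma exists_pairs (k : ℕ) : ∃ p q : Fin (k.choose 2) → Fin k,
    ∀ i j, (p i = p j ∨ p i = q j) → (q i = p j ∨ q i = q j) → i = j := by
  have hc : (Finset.powersetCard 2 (Finset.univ : Finset (Fin k))).card = k.choose 2 := by
    simp
  let e := (Finset.equivFinOfCardEq hc).symm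
  have h : ∀ j, ∃ p q : Fin k, p ≠ q ∧ (e j : Finset (Fin k)) = {p, q} := fun j =>
    Finset.card_eq_two.1 (Finset.mem_powersetCard.1 (e j).2).2
  choose p q hne he using h
  refine ⟨p, q, fun i j h1 h2 => e.injective (Subtype.ext ?_)⟩
  have := hne i
  apply Finset.eq_of_subset_of_card_le
  · rw [he i, he j]
    intro x hx
    simp only [Finset.mem_insert, Finset.mem_singleton] at hx ⊢
    rcases hx with rfl | rfl <;> assumption
  · rw [(Finset.mem_powersetCard.1 (e i).2).2, (Finset.mem_powersetCard.1 (e j).2).2]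

/-- If a predicate `P : {0,1}^r → {0,1}` has an affine projection to AND,
then there is an instance of CSP(P) on `2rk + 2` variables with `C(k,2)` constraints such
that every `(1 ± ε)`-sparsifier (with `ε < 1`) must keep all `C(k,2)` constraints. -/
theorem affine_projection_to_and_hardness
    (r : ℕ) (hr : 2 ≤ r) (P : (Fin r → Bool) → Bool) (hP : HasAffineProjToAND P)
    (k : ℕ) (hk : 2 ≤ k) (ε : ℝ) (hε : ε ∈ Set.Ico (0 : ℝ) 1) :
    ∃ c : Fin (k.choose 2) → Fin r → Fin (2 * r * k + 2),
      ∀ (T : Finset (Fin (k.choose 2))) (w : Fin (k.choose 2) → ℝ),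
        (∀ j ∈ T, 0 ≤ w j) →
        (∀ a : Fin (2 * r * k + 2) → Bool,
          (1 - ε) *
              ((Finset.univ.filter (fun j => P (fun t => a (c j t)) = true)).card : ℝ)
            ≤ (∑ j ∈ T.filter (fun j => P (fun t => a (c j t)) = true), w j) ∧
          (∑ j ∈ T.filter (fun j => P (fun t => a (c j t)) = true), w j)
            ≤ (1 + ε) *
              ((Finset.univ.filter (fun j => P (fun t => a (c j t)) = true)).card : ℝ)) →
        T = Finset.univ := by
  obtain ⟨g, hg, hPg⟩ := hP
  obtain ⟨p, q, hpq⟩ := exists_pairs k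
  have hcard : Fintype.card ((Fin k × Bool) ⊕ Bool) ≤ Fintype.card (Fin (2 * r * k + 2)) := by
    simp only [Fintype.card_sum, Fintype.card_prod, Fintype.card_fin, Fintype.card_bool]
    nlinarith
  obtain ⟨e⟩ := Function.Embedding.nonempty_of_card_le hcard
  choose v hv using fun (j : Fin (k.choose 2)) (t : Fin r) => exists_lit (hg t) (p j) (q j)
  refine ⟨fun j t => e (v j t), fun T w _ hs => ?_⟩
  rw [Finset.eq_univ_iff_forall]
  intro j
  by_contra hj
  let x : Fin k → Bool := fun i => decide (i = p j ∨ i = q j)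
  have : Nonempty ((Fin k × Bool) ⊕ Bool) := ⟨Sum.inr true⟩
  have key : ∀ i, P (fun t => litVal x (Function.invFun e (e (v i t)))) = true ↔ i = j := by
    intro i
    have h1 : (fun t => litVal x (Function.invFun e (e (v i t))))
        = fun t => g t (x (p i)) (x (q i)) := by
      funext t
      rw [Function.leftInverse_invFun e.injective, hv]
    rw [h1, hPg]
    constructor
    · intro h
      simp only [x, Bool.and_eq_true, decide_eq_true_eq] at h
      exact hpq i j h.1 h.2
    · rintro rfl
      simp [x]
  have h := (hs (fun u => litVal x (Function.invFun e u))).1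
  simp only [key] at h
  have hT : T.filter (fun i => i = j) = ∅ := by
    rw [Finset.filter_eq_empty_iff]
    rintro i hi rfl
    exact hj hi
  have hU : (Finset.univ.filter (fun i => i = j)).card = 1 := by
    rw [Finset.card_eq_one]
    exact ⟨j, by ext; simp⟩
  rw [hT, hU] at h
  simp at h
  linarith [hε.2]
end

section
/- Let P : {0,1}³ → {0,1} be a predicate whose number of satisfying assignments |{b ∈ {0,1}³ : P(b) = 1}| is 1, 2, or 3. Then P has an affine projection to AND. -/
/-- The six affine functions, enumerated. -/
def affFun (c : Fin 6) (x y : Bool) : Bool :=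
  match c with
  | 0 => false
  | 1 => true
  | 2 => x
  | 3 => !x
  | 4 => y
  | 5 => !y

theorem affFun_isAffine (c : Fin 6) : IsAffineProjFun (affFun c) := by
  unfold IsAffineProjFun
  revert c
  decide

/-- A ternary predicate given by its truth table. -/
def tab (p0 p1 p2 p3 p4 p5 p6 p7 : Bool) (a b c : Bool) : Bool :=
  cond a (cond b (cond c p7 p6) (cond c p5 p4)) (cond b (cond c p3 p2) (cond c p1 p0))

theorem tab_key : ∀ p0 p1 p2 p3 p4 p5 p6 p7 : Bool,
    (let n := p0.toNat + p1.toNat + p2.toNat + p3.toNat + p4.toNat + p5.toNat + p6.toNat + p7.toNat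
     n = 1 ∨ n = 2 ∨ n = 3) →
    ∃ c0 c1 c2 : Fin 6, ∀ x y : Bool,
      tab p0 p1 p2 p3 p4 p5 p6 p7 (affFun c0 x y) (affFun c1 x y) (affFun c2 x y) = (x && y) := by
  decide +kernel

theorem univ_cube : (Finset.univ : Finset (Fin 3 → Bool)) =
    {![false, false, false], ![false, false, true], ![false, true, false], ![false, true, true],
     ![true, false, false], ![true, false, true], ![true, true, false], ![true, true, true]} := by
  decide +kernel

theorem card_cube (P : (Fin 3 → Bool) → Bool) :
    (Finset.univ.filter (fun b : Fin 3 → Bool => P b = true)).card =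
    (P ![false, false, false]).toNat + (P ![false, false, true]).toNat +
    (P ![false, true, false]).toNat + (P ![false, true, true]).toNat +
    (P ![true, false, false]).toNat + (P ![true, false, true]).toNat +
    (P ![true, true, false]).toNat + (P ![true, true, true]).toNat := by
  have e : ∀ b : Bool, (if b = true then 1 else 0) = b.toNat := by decide
  rw [Finset.card_filter, univ_cube]
  simp only [e]
  repeat rw [Finset.sum_insert (by decide)]
  rw [Finset.sum_singleton]
  omega

theorem tab_eq (P : (Fin 3 → Bool) → Bool) (a b c : Bool) :
    tab (P ![false, false, false]) (P ![false, false, true])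
      (P ![false, true, false]) (P ![false, true, true])
      (P ![true, false, false]) (P ![true, false, true])
      (P ![true, true, false]) (P ![true, true, true]) a b c = P ![a, b, c] := by
  cases a <;> cases b <;> cases c <;> rfl

/-- Every ternary Boolean predicate with 1, 2 or 3 satisfying assignments
has an affine projection to AND. -/
theorem few_satisfying_assignments_has_affine_projection
    (P : (Fin 3 → Bool) → Bool)
    (h : (Finset.univ.filter (fun b : Fin 3 → Bool => P b = true)).card ∈
      ({1, 2, 3} : Set ℕ)) :
    HasAffineProjToAND P := by
  rw [card_cube] at h
  obtain ⟨c0, c1, c2, hc⟩ := tab_key _ _ _ _ _ _ _ _ h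
  refine ⟨fun t => affFun (![c0, c1, c2] t), fun t => affFun_isAffine _, fun x y => ?_⟩
  rw [← hc x y, tab_eq]
  congr 1
  funext t
  fin_cases t <;> rfl
end

section
/- Let P : {0,1}³ → {0,1} be a predicate with no affine projection to AND. Then there exist a prime p and elements a_0, a_1, a_2, a_3 ∈ Z/pZ such that for every b = (b_1,b_2,b_3) ∈ {0,1}³, one has P(b) = 0 if and only if a_0 + a_1·b_1 + a_2·b_2 + a_3·b_3 = 0 in Z/pZ (where each b_i ∈ {0,1} is interpreted as the corresponding element of Z/pZ). -/
/-- The ternary Boolean function with a given truth table. -/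
def tableFun (p0 p1 p2 p3 p4 p5 p6 p7 x y z : Bool) : Bool :=
  cond x (cond y (cond z p7 p6) (cond z p5 p4)) (cond y (cond z p3 p2) (cond z p1 p0))

/-- The six affine projection functions. -/
def affineFuns : List (Bool → Bool → Bool) :=
  [fun x _ => x, fun x _ => !x, fun _ y => y, fun _ y => !y, fun _ _ => false, fun _ _ => true]

lemma isAffineProjFun_of_mem {g : Bool → Bool → Bool} (hg : g ∈ affineFuns) :
    IsAffineProjFun g := by
  simp only [affineFuns, List.mem_cons, List.not_mem_nil, or_false] at hg
  rcases hg with rfl | rfl | rfl | rfl | rfl | rfl <;> simp [IsAffineProjFun]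

/-- Boolean universal quantification over a Boolean. -/
def allBool (f : Bool → Bool) : Bool := f true && f false

lemma allBool_iff (f : Bool → Bool) : allBool f = true ↔ ∀ b, f b = true := by
  simp [allBool, Bool.forall_bool, and_comm]

/-- Search for an affine projection to AND. -/
def projSearch (Q : Bool → Bool → Bool → Bool) : Bool :=
  affineFuns.any fun f => affineFuns.any fun g => affineFuns.any fun k =>
    allBool fun x => allBool fun y => Q (f x y) (g x y) (k x y) == (x && y)

/-- Does the affine equation with the given coefficients modulo `p` describe `Q`? -/
def affCheck (Q : Bool → Bool → Bool → Bool) (p a c d e : ℕ) : Bool :=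
  allBool fun x => allBool fun y => allBool fun z =>
    (!(Q x y z)) == Nat.beq ((a + cond x c 0 + cond y d 0 + cond z e 0) % p) 0

/-- Search for an affine equation modulo `p`; the constant term may be taken in `{0, 1}`. -/
def affSearch (Q : Bool → Bool → Bool → Bool) (p : ℕ) (l : List ℕ) : Bool :=
  [0, 1].any fun a => l.any fun c => l.any fun d => l.any fun e => affCheck Q p a c d e

/-- The finite verification over all truth tables. -/
lemma search_succeeds :
    (allBool fun p0 => allBool fun p1 => allBool fun p2 => allBool fun p3 =>
     allBool fun p4 => allBool fun p5 => allBool fun p6 => allBool fun p7 =>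
      projSearch (tableFun p0 p1 p2 p3 p4 p5 p6 p7) ||
      (affSearch (tableFun p0 p1 p2 p3 p4 p5 p6 p7) 2 [0, 1] ||
       affSearch (tableFun p0 p1 p2 p3 p4 p5 p6 p7) 5 [0, 1, 2, 3, 4])) = true := by
  decide +kernel

lemma affine_of_search {P : (Fin 3 → Bool) → Bool} {Q : Bool → Bool → Bool → Bool}
    (hQ : ∀ b, P b = Q (b 0) (b 1) (b 2)) {p : ℕ} (hp : p.Prime) {l : List ℕ}
    (hs : affSearch Q p l = true) :
    ∃ p : ℕ, p.Prime ∧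
      ∃ a₀ a₁ a₂ a₃ : ZMod p,
        ∀ b : Fin 3 → Bool,
          P b = false ↔
            a₀ + a₁ * (if b 0 then 1 else 0) + a₂ * (if b 1 then 1 else 0) +
                a₃ * (if b 2 then 1 else 0) = 0 := by
  simp only [affSearch, List.any_eq_true] at hs
  obtain ⟨a, -, c, -, d, -, e, -, h⟩ := hs
  simp only [affCheck, allBool_iff] at h
  refine ⟨p, hp, a, c, d, e, fun b => ?_⟩
  have hb := h (b 0) (b 1) (b 2)
  have hz : (a : ZMod p) + c * (if b 0 then 1 else 0) + d * (if b 1 then 1 else 0) +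
      e * (if b 2 then 1 else 0) =
      ((a + cond (b 0) c 0 + cond (b 1) d 0 + cond (b 2) e 0 : ℕ) : ZMod p) := by
    cases b 0 <;> cases b 1 <;> cases b 2 <;> simp
  rw [hz, ZMod.natCast_eq_zero_iff, Nat.dvd_iff_mod_eq_zero, hQ, ← Nat.beq_eq,
    ← beq_iff_eq.mp hb]
  simp

/-- Every ternary Boolean predicate with no affine projection to AND has
its unsatisfying assignments given exactly by the zero set of an affine equation modulo
some prime. -/
theorem no_affine_projection_implies_affine_equation
    (P : (Fin 3 → Bool) → Bool) (h : ¬ HasAffineProjToAND P) :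
    ∃ p : ℕ, p.Prime ∧
      ∃ a₀ a₁ a₂ a₃ : ZMod p,
        ∀ b : Fin 3 → Bool,
          P b = false ↔
            a₀ + a₁ * (if b 0 then 1 else 0) + a₂ * (if b 1 then 1 else 0) +
                a₃ * (if b 2 then 1 else 0) = 0 := by
  obtain ⟨Q, hQ⟩ : ∃ Q : Bool → Bool → Bool → Bool, Q = fun x y z => P ![x, y, z] := ⟨_, rfl⟩
  have hPQ : ∀ b, P b = Q (b 0) (b 1) (b 2) := by
    intro b
    rw [hQ]
    congr 1
    ext i
    fin_cases i <;> rfl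
  have hT : Q = tableFun (Q false false false) (Q false false true) (Q false true false)
      (Q false true true) (Q true false false) (Q true false true) (Q true true false)
      (Q true true true) := by
    funext x y z
    cases x <;> cases y <;> cases z <;> rfl
  have key := search_succeeds
  simp only [allBool_iff] at key
  have hk := key (Q false false false) (Q false false true) (Q false true false)
      (Q false true true) (Q true false false) (Q true false true) (Q true true false)
      (Q true true true)
  rw [← hT, Bool.or_eq_true, Bool.or_eq_true] at hk
  rcases hk with hk | hk | hk
  · exfalso
    apply h
    simp only [projSearch, List.any_eq_true, allBool_iff] at hk
    obtain ⟨f, hf, g, hg, k, hk, hall⟩ := hk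
    refine ⟨![f, g, k], ?_, fun x y => ?_⟩
    · intro t
      fin_cases t
      · exact isAffineProjFun_of_mem hf
      · exact isAffineProjFun_of_mem hg
      · exact isAffineProjFun_of_mem hk
    · rw [hPQ]
      exact beq_iff_eq.mp (hall x y)
  · exact affine_of_search hPQ Nat.prime_two hk
  · exact affine_of_search hPQ Nat.prime_five hk
end
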